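/- Let χ > 0, assume (B) and (init), and let (u, v) be the maximal classical solution of the crime model on Ω̄ × [0, T_max). Let p ∈ (0,1) satisfy p < 1/χ², and let q ∈ (q⁻(p), q⁺(p)), where q^±(p) := (1−p)/2 · (1 ± √(1 − pχ²)). Then for all T > 0 there exists C(T) > 0 such that, with T̂_max := min{T, T_max} and τ := min{1, T_max/3}, both ∫_t^{t+τ} ∫_Ω u^{p−2} v^q (u_x)² ≤ C(T) and ∫_t^{t+τ} ∫_Ω u^p v^{q−2} (v_x)² ≤ C(T) hold for all t ∈ (0, T̂_max − τ), and sup_{T>0} C(T) < ∞ if either hypothesis (H1) or hypothesis (H2) holds. -/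

import Mathlib

open Real MeasureTheory Filter Topology Set
open scoped ENNReal NNReal

noncomputable section

/-- Partial derivative of a space-time function in the first (space) variable. -/
def pdx (f : ℝ → ℝ → ℝ) : ℝ → ℝ → ℝ := fun x t => deriv (fun y => f y t) x

/-- Partial derivative of a space-time function in the second (time) variable. -/
def pdt (f : ℝ → ℝ → ℝ) : ℝ → ℝ → ℝ := fun x t => deriv (fun s => f x s) t

/-- The time interval `[0, Tmax)` (with `Tmax ∈ (0,∞]`). -/
def It (Tmax : ℝ≥0∞) : Set ℝ := {t : ℝ | 0 ≤ t ∧ ENNReal.ofReal t < Tmax}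

/-- The time interval `(0, Tmax)` (with `Tmax ∈ (0,∞]`). -/
def It' (Tmax : ℝ≥0∞) : Set ℝ := {t : ℝ | 0 < t ∧ ENNReal.ofReal t < Tmax}

/-- The waiting time `τ := min{1, Tmax/3}`, as a real number. -/
def tauOf (Tmax : ℝ≥0∞) : ℝ := (min 1 (Tmax / 3)).toReal

/-- Hypothesis (B): `B` is nonnegative, bounded, and locally Hölder continuous on
`Ω̄ × [0,∞)` with some exponent `ϑ ∈ (0,1)`. -/
def HypB (a b : ℝ) (B : ℝ → ℝ → ℝ) : Prop :=
  (∀ x t : ℝ, 0 ≤ B x t) ∧ (∃ M : ℝ, ∀ x t : ℝ, B x t ≤ M) ∧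
  ∃ ϑ : ℝ, ϑ ∈ Set.Ioo (0:ℝ) 1 ∧
    ∀ K : Set (ℝ × ℝ), IsCompact K → K ⊆ (Set.Icc a b) ×ˢ (Set.Ici (0:ℝ)) →
      ∃ C : ℝ, ∀ p ∈ K, ∀ q ∈ K, |B p.1 p.2 - B q.1 q.2| ≤ C * dist p q ^ ϑ

/-- Hypothesis (init): `u0 ∈ C⁰(Ω̄)` nonnegative, `v0 ∈ W^{1,∞}(Ω)` (i.e. Lipschitz)
positive on `Ω̄`. -/
def HypInit (a b : ℝ) (u0 v0 : ℝ → ℝ) : Prop :=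
  ContinuousOn u0 (Set.Icc a b) ∧ (∀ x ∈ Set.Icc a b, 0 ≤ u0 x) ∧
  (∃ L : ℝ≥0, LipschitzOnWith L v0 (Set.Icc a b)) ∧ (∀ x ∈ Set.Icc a b, 0 < v0 x)

/-- Hypothesis (H1): `∫_0^∞ ∫_Ω B1 < ∞`. -/
def HypH1 (a b : ℝ) (B1 : ℝ → ℝ → ℝ) : Prop :=
  MeasureTheory.IntegrableOn (fun p : ℝ × ℝ => B1 p.1 p.2)
    ((Set.Ioo a b) ×ˢ (Set.Ioi (0:ℝ)))

/-- Hypothesis (H1'): `∫_t^{t+1} ∫_Ω B1 → 0` as `t → ∞`. -/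
def HypH1' (a b : ℝ) (B1 : ℝ → ℝ → ℝ) : Prop :=
  Filter.Tendsto (fun t : ℝ => ∫ s in t..(t+1), ∫ x in Set.Ioo a b, B1 x s)
    Filter.atTop (nhds 0)

/-- Hypothesis (H2): `inf_{t>0} ∫_Ω B2(·,t) > 0`. -/
def HypH2 (a b : ℝ) (B2 : ℝ → ℝ → ℝ) : Prop :=
  ∃ c : ℝ, 0 < c ∧ ∀ t : ℝ, 0 < t → c ≤ ∫ x in Set.Ioo a b, B2 x t

/-- Hypothesis (H3): `B2(·,t)` stabilizes to `B2inf ∈ L²(Ω)` in the averaged `L²` sense. -/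
def HypH3 (a b : ℝ) (B2 : ℝ → ℝ → ℝ) (B2inf : ℝ → ℝ) : Prop :=
  MeasureTheory.MemLp B2inf 2 (MeasureTheory.volume.restrict (Set.Ioo a b)) ∧
  Filter.Tendsto
    (fun t : ℝ => ∫ s in t..(t+1), ∫ x in Set.Ioo a b, (B2 x s - B2inf x)^2)
    Filter.atTop (nhds 0)

/-- A classical solution of the urban crime system
`u_t = u_xx − χ (u/v · v_x)_x − uv + B1`, `v_t = v_xx + uv − v + B2` on
`Ω̄ × [0, Tmax)`, `Ω = (a,b)`, with homogeneous Neumann boundary conditions and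
initial data `(u0, v0)`; `u, v` are positive on `Ω̄ × (0, Tmax)`, belong to
`C⁰(Ω̄ × [0,Tmax)) ∩ C^{2,1}(Ω̄ × (0,Tmax))` and `v(·,t)` lies in `W^{1,r}(Ω)`,
continuously in `t`, for every `r > 1`. -/
structure CrimeSol (a b χ : ℝ) (B1 B2 : ℝ → ℝ → ℝ) (u0 v0 : ℝ → ℝ)
    (u v : ℝ → ℝ → ℝ) (Tmax : ℝ≥0∞) : Prop where
  u_cont : ContinuousOn (fun p : ℝ × ℝ => u p.1 p.2) ((Set.Icc a b) ×ˢ It Tmax)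
  v_cont : ContinuousOn (fun p : ℝ × ℝ => v p.1 p.2) ((Set.Icc a b) ×ˢ It Tmax)
  u_init : ∀ x ∈ Set.Icc a b, u x 0 = u0 x
  v_init : ∀ x ∈ Set.Icc a b, v x 0 = v0 x
  u_pos : ∀ x ∈ Set.Icc a b, ∀ t ∈ It' Tmax, 0 < u x t
  v_pos : ∀ x ∈ Set.Icc a b, ∀ t ∈ It' Tmax, 0 < v x t
  u_reg : ∀ x ∈ Set.Icc a b, ∀ t ∈ It' Tmax,
    DifferentiableAt ℝ (fun y => u y t) x ∧
    DifferentiableAt ℝ (fun y => pdx u y t) x ∧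
    DifferentiableAt ℝ (fun s => u x s) t
  v_reg : ∀ x ∈ Set.Icc a b, ∀ t ∈ It' Tmax,
    DifferentiableAt ℝ (fun y => v y t) x ∧
    DifferentiableAt ℝ (fun y => pdx v y t) x ∧
    DifferentiableAt ℝ (fun s => v x s) t
  u_cont21 : ContinuousOn
    (fun p : ℝ × ℝ => (pdx u p.1 p.2, pdx (pdx u) p.1 p.2, pdt u p.1 p.2))
    ((Set.Icc a b) ×ˢ It' Tmax)
  v_cont21 : ContinuousOn
    (fun p : ℝ × ℝ => (pdx v p.1 p.2, pdx (pdx v) p.1 p.2, pdt v p.1 p.2))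
    ((Set.Icc a b) ×ˢ It' Tmax)
  v_W1r : ∀ r : ℝ, 1 < r →
    (∀ t ∈ It Tmax,
      MeasureTheory.IntegrableOn (fun x => |pdx v x t| ^ r) (Set.Ioo a b)) ∧
    ContinuousOn (fun t => ∫ x in Set.Ioo a b, |pdx v x t| ^ r) (It Tmax)
  u_eq : ∀ x ∈ Set.Ioo a b, ∀ t ∈ It' Tmax,
    pdt u x t = pdx (pdx u) x t
      - χ * pdx (fun y s => u y s / v y s * pdx v y s) x t
      - u x t * v x t + B1 x t
  v_eq : ∀ x ∈ Set.Ioo a b, ∀ t ∈ It' Tmax,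
    pdt v x t = pdx (pdx v) x t + u x t * v x t - v x t + B2 x t
  u_bc : ∀ t ∈ It' Tmax, pdx u a t = 0 ∧ pdx u b t = 0
  v_bc : ∀ t ∈ It' Tmax, pdx v a t = 0 ∧ pdx v b t = 0

/-- A classical solution of the stationary Neumann problem
`−w'' + w = B` in `Ω = (a,b)`, `w' = 0` on `∂Ω`. -/
def IsStationarySol (a b : ℝ) (B : ℝ → ℝ) (w : ℝ → ℝ) : Prop :=
  ContinuousOn w (Set.Icc a b) ∧
  (∀ x ∈ Set.Icc a b, DifferentiableAt ℝ w x ∧ DifferentiableAt ℝ (deriv w) x) ∧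
  (∀ x ∈ Set.Ioo a b, -(deriv (deriv w) x) + w x = B x) ∧
  deriv w a = 0 ∧ deriv w b = 0

/-- The branches `q^±(p) = (1−p)/2 · (1 ∓/± √(1 − pχ²))`. -/
def qminus (χ p : ℝ) : ℝ := (1 - p) / 2 * (1 - Real.sqrt (1 - p * χ^2))

def qplus (χ p : ℝ) : ℝ := (1 - p) / 2 * (1 + Real.sqrt (1 - p * χ^2))

/-- The auxiliary functions `φ₁, φ₂, φ₃` and the constant `p₀`. -/
def phi1 (p : ℝ) : ℝ := (p + 1) / (1 - p)

def phi2 (χ p : ℝ) : ℝ := (1 - p) / (2 * p) * (1 + Real.sqrt (1 - p * χ^2))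

def phi3 (χ p : ℝ) : ℝ := (1 - p) / (2 * p) * (1 - Real.sqrt (1 - p * χ^2))

def p0 : ℝ := (2 * Real.sqrt 3 - 3) / 3


/-- Chain rule for a function of two positive variables. -/
def ChainR (G Gu Gv : ℝ → ℝ → ℝ) : Prop :=
  ∀ (f g : ℝ → ℝ) (f' g' s : ℝ), 0 < f s → 0 < g s → HasDerivAt f f' s → HasDerivAt g g' s →
    HasDerivAt (fun r => G (f r) (g r)) (Gu (f s) (g s) * f' + Gv (f s) (g s) * g') s

def ContQ (G : ℝ → ℝ → ℝ) : Prop :=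
  ContinuousOn (fun z : ℝ × ℝ => G z.1 z.2) (Set.Ioi (0:ℝ) ×ˢ Set.Ioi (0:ℝ))

lemma isOpen_It' (Tmax : ℝ≥0∞) : IsOpen (It' Tmax) := by
  have : It' Tmax = Set.Ioi 0 ∩ {t : ℝ | ENNReal.ofReal t < Tmax} := by
    ext t; simp [It']
  rw [this]
  exact isOpen_Ioi.inter (isOpen_lt ENNReal.continuous_ofReal continuous_const)

lemma It'_sub (Tmax : ℝ≥0∞) : It' Tmax ⊆ It Tmax := fun _ h => ⟨h.1.le, h.2⟩

lemma Icc_sub_It' {Tmax : ℝ≥0∞} {s t : ℝ} (hs : 0 < s) (ht : ENNReal.ofReal t < Tmax) :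
    Set.Icc s t ⊆ It' Tmax := fun _ h =>
  ⟨lt_of_lt_of_le hs h.1, lt_of_le_of_lt (ENNReal.ofReal_le_ofReal h.2) ht⟩

lemma Icc_sub_It {Tmax : ℝ≥0∞} {t : ℝ} (ht : ENNReal.ofReal t < Tmax) :
    Set.Icc 0 t ⊆ It Tmax := fun _ h =>
  ⟨h.1, lt_of_le_of_lt (ENNReal.ofReal_le_ofReal h.2) ht⟩

lemma cont_param {a b : ℝ} (hab : a ≤ b) {S : Set ℝ} {f : ℝ → ℝ → ℝ}
    (hf : ContinuousOn (fun z : ℝ × ℝ => f z.1 z.2) (Set.Icc a b ×ˢ S)) :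
    ContinuousOn (fun t => ∫ x in a..b, f x t) S := by
  rw [continuousOn_iff_continuous_domRestrict]
  have h1 : Continuous (Function.uncurry
      (fun (t : S) (x : ℝ) => f (Set.projIcc a b hab x : ℝ) (t : ℝ))) := by
    have : Continuous (fun z : S × ℝ => (((Set.projIcc a b hab z.2 : Set.Icc a b) : ℝ), (z.1 : ℝ))) := by
      fun_prop
    exact hf.comp_continuous this (fun z => ⟨(Set.projIcc a b hab z.2).2, z.1.2⟩)
  have h2 := intervalIntegral.continuous_parametric_intervalIntegral_of_continuous'
    (μ := volume) h1 a b
  convert h2 using 1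
  funext t
  simp only [Set.domRestrict_apply]
  refine intervalIntegral.integral_congr (fun x hx => ?_)
  rw [Set.uIcc_of_le hab] at hx
  simp only [Set.projIcc_of_mem hab hx]

lemma cont_slice {a b : ℝ} {S : Set ℝ} {f : ℝ → ℝ → ℝ}
    (hf : ContinuousOn (fun z : ℝ × ℝ => f z.1 z.2) (Set.Icc a b ×ˢ S)) {t : ℝ} (ht : t ∈ S) :
    ContinuousOn (fun x => f x t) (Set.Icc a b) := by
  have : ContinuousOn (fun x : ℝ => ((x, t) : ℝ × ℝ)) (Set.Icc a b) := by fun_prop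
  exact hf.comp this (fun x hx => ⟨hx, ht⟩)

lemma ii_of_cont {a b : ℝ} (hab : a ≤ b) {f : ℝ → ℝ} (hf : ContinuousOn f (Set.Icc a b)) :
    IntervalIntegrable f volume a b :=
  hf.intervalIntegrable_of_Icc hab

lemma deriv_param {a b : ℝ} (hab : a ≤ b) {S : Set ℝ} (hS : IsOpen S) {f f' : ℝ → ℝ → ℝ}
    (hf : ContinuousOn (fun z : ℝ × ℝ => f z.1 z.2) (Set.Icc a b ×ˢ S))
    (hf' : ContinuousOn (fun z : ℝ × ℝ => f' z.1 z.2) (Set.Icc a b ×ˢ S))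
    (hd : ∀ x ∈ Set.Icc a b, ∀ t ∈ S, HasDerivAt (fun s => f x s) (f' x t) t)
    {t : ℝ} (ht : t ∈ S) :
    HasDerivAt (fun s => ∫ x in a..b, f x s) (∫ x in a..b, f' x t) t := by
  obtain ⟨ε, hε, hεS⟩ := Metric.nhds_basis_closedBall.mem_iff.1 (hS.mem_nhds ht)
  have hcomp : IsCompact (Set.Icc a b ×ˢ Metric.closedBall t ε) :=
    isCompact_Icc.prod (isCompact_closedBall t ε)
  obtain ⟨M, hM⟩ := hcomp.exists_bound_of_continuousOn
    (hf'.mono (Set.prod_mono_right hεS))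
  have hsub : Set.uIoc a b ⊆ Set.Icc a b := by
    rw [Set.uIoc_of_le hab]; exact Set.Ioc_subset_Icc_self
  refine (intervalIntegral.hasDerivAt_integral_of_dominated_loc_of_deriv_le
    (F := fun s x => f x s) (F' := fun s x => f' x s) (bound := fun _ => M)
    (Metric.closedBall_mem_nhds t hε) ?_ ?_ ?_ ?_ ?_ ?_).2
  · filter_upwards [hS.mem_nhds ht] with s hs
    exact ((cont_slice hf hs).mono hsub).aestronglyMeasurable measurableSet_uIoc
  · exact ii_of_cont hab (cont_slice hf ht)
  · exact ((cont_slice hf' ht).mono hsub).aestronglyMeasurable measurableSet_uIoc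
  · exact Filter.Eventually.of_forall (fun x hx s hs => hM (x, s) ⟨hsub hx, hs⟩)
  · exact intervalIntegrable_const
  · exact Filter.Eventually.of_forall (fun x hx s hs => hd x (hsub hx) s (hεS hs))

lemma HypB.cont {a b : ℝ} {B : ℝ → ℝ → ℝ} (h : HypB a b B) :
    ContinuousOn (fun z : ℝ × ℝ => B z.1 z.2) (Set.Icc a b ×ˢ Set.Ici (0:ℝ)) := by
  obtain ⟨-, -, θ, hθ, hK⟩ := h
  intro z hz
  obtain ⟨C, hC⟩ := hK (Set.Icc a b ×ˢ Set.Icc 0 (z.2 + 1)) (isCompact_Icc.prod isCompact_Icc)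
    (Set.prod_mono_right Set.Icc_subset_Ici_self)
  have hzK : z ∈ Set.Icc a b ×ˢ Set.Icc 0 (z.2 + 1) := ⟨hz.1, hz.2, by linarith⟩
  have hev : ∀ᶠ w in 𝓝[Set.Icc a b ×ˢ Set.Ici (0:ℝ)] z,
      dist (B w.1 w.2) (B z.1 z.2) ≤ C * dist w z ^ θ := by
    have h1 : ∀ᶠ w : ℝ × ℝ in 𝓝[Set.Icc a b ×ˢ Set.Ici (0:ℝ)] z, w.2 < z.2 + 1 :=
      nhdsWithin_le_nhds ((isOpen_lt continuous_snd continuous_const).mem_nhds (by simp))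
    filter_upwards [h1, self_mem_nhdsWithin] with w hw1 hw2
    rw [Real.dist_eq]
    exact hC w ⟨hw2.1, hw2.2, hw1.le⟩ z hzK
  have hlim : Filter.Tendsto (fun w : ℝ × ℝ => C * dist w z ^ θ)
      (𝓝[Set.Icc a b ×ˢ Set.Ici (0:ℝ)] z) (𝓝 0) := by
    have : ContinuousAt (fun w : ℝ × ℝ => C * dist w z ^ θ) z := by
      refine continuousAt_const.mul (ContinuousAt.rpow_const (by fun_prop) (Or.inr hθ.1.le))
    have h2 := this.tendsto
    simp only [dist_self, Real.zero_rpow hθ.1.ne', mul_zero] at h2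
    exact h2.mono_left nhdsWithin_le_nhds
  rw [ContinuousWithinAt, tendsto_iff_dist_tendsto_zero]
  exact squeeze_zero' (Filter.Eventually.of_forall fun _ => dist_nonneg) hev hlim

section sol

variable {a b χ : ℝ} {B1 B2 : ℝ → ℝ → ℝ} {u0 v0 : ℝ → ℝ} {u v : ℝ → ℝ → ℝ} {Tmax : ℝ≥0∞}

/-- The integrand of the time derivative of `∫ G(u,v)`. -/
def Igd (χ : ℝ) (B1 B2 u v Gu Gv Guu Guv Gvv : ℝ → ℝ → ℝ) (x t : ℝ) : ℝ :=
  -((Guu (u x t) (v x t) * pdx u x t + Guv (u x t) (v x t) * pdx v x t)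
      * (pdx u x t - χ * (u x t / v x t * pdx v x t)))
  - (Guv (u x t) (v x t) * pdx u x t + Gvv (u x t) (v x t) * pdx v x t) * pdx v x t
  + Gu (u x t) (v x t) * (- u x t * v x t + B1 x t)
  + Gv (u x t) (v x t) * (u x t * v x t - v x t + B2 x t)

lemma CrimeSol.comp_cont (hsol : CrimeSol a b χ B1 B2 u0 v0 u v Tmax)
    {G : ℝ → ℝ → ℝ} (hG : ContQ G) :
    ContinuousOn (fun z : ℝ × ℝ => G (u z.1 z.2) (v z.1 z.2)) (Set.Icc a b ×ˢ It' Tmax) := by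
  have hu := hsol.u_cont.mono (Set.prod_mono_right (It'_sub Tmax))
  have hv := hsol.v_cont.mono (Set.prod_mono_right (It'_sub Tmax))
  exact hG.comp (hu.prodMk hv) (fun z hz => ⟨hsol.u_pos _ hz.1 _ hz.2, hsol.v_pos _ hz.1 _ hz.2⟩)

lemma CrimeSol.functional (hab : a < b) (hB1 : HypB a b B1) (hB2 : HypB a b B2)
    (hsol : CrimeSol a b χ B1 B2 u0 v0 u v Tmax)
    {G Gu Gv Guu Guv Gvv : ℝ → ℝ → ℝ} (hG : ContQ G) (hGu : ContQ Gu) (hGv : ContQ Gv)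
    (hGuu : ContQ Guu) (hGuv : ContQ Guv) (hGvv : ContQ Gvv)
    (c : ChainR G Gu Gv) (cu : ChainR Gu Guu Guv) (cv : ChainR Gv Guv Gvv)
    {t : ℝ} (ht : t ∈ It' Tmax) :
    ContinuousOn (fun x => Igd χ B1 B2 u v Gu Gv Guu Guv Gvv x t) (Set.Icc a b) ∧
    HasDerivAt (fun s => ∫ x in a..b, G (u x s) (v x s))
      (∫ x in a..b, Igd χ B1 B2 u v Gu Gv Guu Guv Gvv x t) t := by
  have hu := hsol.u_cont.mono (Set.prod_mono_right (It'_sub Tmax))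
  have hv := hsol.v_cont.mono (Set.prod_mono_right (It'_sub Tmax))
  have hux : ContinuousOn (fun z : ℝ × ℝ => pdx u z.1 z.2) (Set.Icc a b ×ˢ It' Tmax) :=
    continuous_fst.comp_continuousOn hsol.u_cont21
  have huxx : ContinuousOn (fun z : ℝ × ℝ => pdx (pdx u) z.1 z.2) (Set.Icc a b ×ˢ It' Tmax) :=
    (continuous_fst.comp continuous_snd).comp_continuousOn hsol.u_cont21
  have hut : ContinuousOn (fun z : ℝ × ℝ => pdt u z.1 z.2) (Set.Icc a b ×ˢ It' Tmax) :=
    (continuous_snd.comp continuous_snd).comp_continuousOn hsol.u_cont21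
  have hvx : ContinuousOn (fun z : ℝ × ℝ => pdx v z.1 z.2) (Set.Icc a b ×ˢ It' Tmax) :=
    continuous_fst.comp_continuousOn hsol.v_cont21
  have hvxx : ContinuousOn (fun z : ℝ × ℝ => pdx (pdx v) z.1 z.2) (Set.Icc a b ×ˢ It' Tmax) :=
    (continuous_fst.comp continuous_snd).comp_continuousOn hsol.v_cont21
  have hvt : ContinuousOn (fun z : ℝ × ℝ => pdt v z.1 z.2) (Set.Icc a b ×ˢ It' Tmax) :=
    (continuous_snd.comp continuous_snd).comp_continuousOn hsol.v_cont21
  have kGu := hsol.comp_cont hGu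
  have kGv := hsol.comp_cont hGv
  have ht0 : t ∈ Set.Ici (0:ℝ) := ht.1.le
  -- slices
  have su := cont_slice hu ht
  have sv := cont_slice hv ht
  have sux := cont_slice hux ht
  have suxx := cont_slice huxx ht
  have svx := cont_slice hvx ht
  have svxx := cont_slice hvxx ht
  have sGu := cont_slice (f := fun x t => Gu (u x t) (v x t)) kGu ht
  have sGv := cont_slice (f := fun x t => Gv (u x t) (v x t)) kGv ht
  have sGuu := cont_slice (f := fun x t => Guu (u x t) (v x t)) (hsol.comp_cont hGuu) ht
  have sGuv := cont_slice (f := fun x t => Guv (u x t) (v x t)) (hsol.comp_cont hGuv) ht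
  have sGvv := cont_slice (f := fun x t => Gvv (u x t) (v x t)) (hsol.comp_cont hGvv) ht
  have sB1 := cont_slice hB1.cont ht0
  have sB2 := cont_slice hB2.cont ht0
  have hvne : ∀ x ∈ Set.Icc a b, v x t ≠ 0 := fun x hx => (hsol.v_pos x hx t ht).ne'
  have hcI : ContinuousOn (fun x => Igd χ B1 B2 u v Gu Gv Guu Guv Gvv x t) (Set.Icc a b) := by
    have sq := su.div sv hvne
    unfold Igd
    exact (((((sGuu.mul sux).add (sGuv.mul svx)).mul
      (sux.sub (continuousOn_const.mul (sq.mul svx)))).neg.sub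
      (((sGuv.mul sux).add (sGvv.mul svx)).mul svx)).add
      (sGu.mul ((su.neg.mul sv).add sB1))).add (sGv.mul (((su.mul sv).sub sv).add sB2))
  refine ⟨hcI, ?_⟩
  have hD := deriv_param hab.le (isOpen_It' Tmax)
    (f := fun x t => G (u x t) (v x t))
    (f' := fun x t => Gu (u x t) (v x t) * pdt u x t + Gv (u x t) (v x t) * pdt v x t)
    (hsol.comp_cont hG) ((kGu.mul hut).add (kGv.mul hvt))
    (fun x hx s hs => c _ _ _ _ _ (hsol.u_pos x hx s hs) (hsol.v_pos x hx s hs)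
      (hsol.u_reg x hx s hs).2.2.hasDerivAt (hsol.v_reg x hx s hs).2.2.hasDerivAt) ht
  convert hD using 1
  -- spatial derivatives
  have dux : ∀ x ∈ Set.Icc a b, HasDerivAt (fun y => u y t) (pdx u x t) x :=
    fun x hx => (hsol.u_reg x hx t ht).1.hasDerivAt
  have duxx : ∀ x ∈ Set.Icc a b, HasDerivAt (fun y => pdx u y t) (pdx (pdx u) x t) x :=
    fun x hx => (hsol.u_reg x hx t ht).2.1.hasDerivAt
  have dvx : ∀ x ∈ Set.Icc a b, HasDerivAt (fun y => v y t) (pdx v x t) x :=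
    fun x hx => (hsol.v_reg x hx t ht).1.hasDerivAt
  have dvxx : ∀ x ∈ Set.Icc a b, HasDerivAt (fun y => pdx v y t) (pdx (pdx v) x t) x :=
    fun x hx => (hsol.v_reg x hx t ht).2.1.hasDerivAt
  set R : ℝ → ℝ := fun x => (pdx u x t * v x t - u x t * pdx v x t) / (v x t) ^ 2 * pdx v x t
    + u x t / v x t * pdx (pdx v) x t with hR
  have dR : ∀ x ∈ Set.Icc a b, HasDerivAt (fun y => u y t / v y t * pdx v y t) (R x) x :=
    fun x hx => ((dux x hx).div (dvx x hx) (hvne x hx)).mul (dvxx x hx)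
  have sR : ContinuousOn R (Set.Icc a b) :=
    ((((sux.mul sv).sub (su.mul svx)).div (sv.pow 2)
      (fun x hx => pow_ne_zero 2 (hvne x hx))).mul svx).add ((su.div sv hvne).mul svxx)
  have dJ : ∀ x ∈ Set.uIcc a b, HasDerivAt (fun y => pdx u y t - χ * (u y t / v y t * pdx v y t))
      (pdx (pdx u) x t - χ * R x) x := by
    intro x hx
    rw [Set.uIcc_of_le hab.le] at hx
    exact (duxx x hx).sub ((dR x hx).const_mul χ)
  have dGu : ∀ x ∈ Set.uIcc a b, HasDerivAt (fun y => Gu (u y t) (v y t))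
      (Guu (u x t) (v x t) * pdx u x t + Guv (u x t) (v x t) * pdx v x t) x := by
    intro x hx
    rw [Set.uIcc_of_le hab.le] at hx
    exact cu (fun y => u y t) (fun y => v y t) _ _ x (hsol.u_pos x hx t ht) (hsol.v_pos x hx t ht)
      (dux x hx) (dvx x hx)
  have dGv : ∀ x ∈ Set.uIcc a b, HasDerivAt (fun y => Gv (u y t) (v y t))
      (Guv (u x t) (v x t) * pdx u x t + Gvv (u x t) (v x t) * pdx v x t) x := by
    intro x hx
    rw [Set.uIcc_of_le hab.le] at hx
    exact cv (fun y => u y t) (fun y => v y t) _ _ x (hsol.u_pos x hx t ht) (hsol.v_pos x hx t ht)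
      (dux x hx) (dvx x hx)
  have sGux := (sGuu.mul sux).add (sGuv.mul svx)
  have sGvx := (sGuv.mul sux).add (sGvv.mul svx)
  have sJx : ContinuousOn (fun x => pdx (pdx u) x t - χ * R x) (Set.Icc a b) :=
    suxx.sub (continuousOn_const.mul sR)
  have sJ : ContinuousOn (fun y => pdx u y t - χ * (u y t / v y t * pdx v y t)) (Set.Icc a b) :=
    sux.sub (continuousOn_const.mul ((su.div sv hvne).mul svx))
  have ibp1 := intervalIntegral.integral_mul_deriv_eq_deriv_mul dGu dJ
    (ii_of_cont hab.le sGux) (ii_of_cont hab.le sJx)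
  have ibp2 := intervalIntegral.integral_mul_deriv_eq_deriv_mul dGv
    (fun x hx => dvxx x (by rwa [Set.uIcc_of_le hab.le] at hx))
    (ii_of_cont hab.le sGvx) (ii_of_cont hab.le svxx)
  obtain ⟨ua, ub⟩ := hsol.u_bc t ht
  obtain ⟨va, vb⟩ := hsol.v_bc t ht
  simp only [ua, ub, va, vb, mul_zero, sub_zero, zero_sub] at ibp1 ibp2
  have e1 : ∫ x in a..b, (Gu (u x t) (v x t) * pdt u x t + Gv (u x t) (v x t) * pdt v x t)
      = ∫ x in a..b, (Gu (u x t) (v x t) * (pdx (pdx u) x t - χ * R x)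
        + Gv (u x t) (v x t) * pdx (pdx v) x t
        + (Gu (u x t) (v x t) * (- u x t * v x t + B1 x t)
        + Gv (u x t) (v x t) * (u x t * v x t - v x t + B2 x t))) := by
    rw [intervalIntegral.integral_of_le hab.le, intervalIntegral.integral_of_le hab.le,
      integral_Ioc_eq_integral_Ioo, integral_Ioc_eq_integral_Ioo]
    refine setIntegral_congr_fun measurableSet_Ioo (fun x hx => ?_)
    have h1 := hsol.u_eq x hx t ht
    have h2 := hsol.v_eq x hx t ht
    have h3 : pdx (fun y s => u y s / v y s * pdx v y s) x t = R x :=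
      (dR x (Set.Ioo_subset_Icc_self hx)).deriv
    simp only [h1, h2, h3]
    ring
  have sre : ContinuousOn (fun x => Gu (u x t) (v x t) * (- u x t * v x t + B1 x t)
        + Gv (u x t) (v x t) * (u x t * v x t - v x t + B2 x t)) (Set.Icc a b) :=
    (sGu.mul ((su.neg.mul sv).add sB1)).add (sGv.mul (((su.mul sv).sub sv).add sB2))
  rw [e1, intervalIntegral.integral_add, intervalIntegral.integral_add, ibp1, ibp2,
    ← intervalIntegral.integral_neg, ← intervalIntegral.integral_neg,
    ← intervalIntegral.integral_add, ← intervalIntegral.integral_add]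
  · refine intervalIntegral.integral_congr (fun x _ => ?_)
    simp only [Igd]
    ring
  · exact ii_of_cont hab.le ((sGux.mul sJ).neg.add (sGvx.mul svx).neg)
  · exact ii_of_cont hab.le sre
  · exact ii_of_cont hab.le (sGux.mul sJ).neg
  · exact ii_of_cont hab.le (sGvx.mul svx).neg
  · exact ii_of_cont hab.le (sGu.mul sJx)
  · exact ii_of_cont hab.le (sGv.mul svxx)
  · exact ii_of_cont hab.le ((sGu.mul sJx).add (sGv.mul svxx))
  · exact ii_of_cont hab.le sre

end sol

lemma gron {E E' : ℝ → ℝ} {δ K t : ℝ} (hδ : 0 < δ) (hK : 0 ≤ K) (ht : 0 ≤ t)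
    (hc : ContinuousOn E (Set.Icc 0 t)) (hd : ∀ s ∈ Set.Ioo 0 t, HasDerivAt E (E' s) s)
    (hle : ∀ s ∈ Set.Ioo 0 t, E' s ≤ K - δ * E s) : E t ≤ |E 0| + K / δ := by
  have h := intervalIntegral.sub_le_integral_of_hasDeriv_right_of_le (φ := fun _ => (0:ℝ))
    (g := fun s => Real.exp (δ * s) * (E s - K / δ))
    (g' := fun s => Real.exp (δ * s) * δ * (E s - K / δ) + Real.exp (δ * s) * E' s)
    ht (by fun_prop) (fun s hs => by
      have h1 : HasDerivAt (fun s => Real.exp (δ * s)) (Real.exp (δ * s) * δ) s := by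
        simpa using ((hasDerivAt_id s).const_mul δ).exp
      exact (h1.mul ((hd s hs).sub_const (K / δ))).hasDerivWithinAt)
    (by simp) (fun s hs => by
      have h1 := hle s hs
      have h2 : δ * (K / δ) = K := by field_simp
      have : Real.exp (δ * s) * δ * (E s - K / δ) + Real.exp (δ * s) * E' s
        = Real.exp (δ * s) * (δ * E s - δ * (K / δ) + E' s) := by ring
      rw [this, h2]
      exact mul_nonpos_of_nonneg_of_nonpos (Real.exp_pos _).le (by linarith))
  simp only [intervalIntegral.integral_zero, mul_zero, Real.exp_zero, one_mul] at h
  have hKd : 0 ≤ K / δ := div_nonneg hK hδ.le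
  by_contra hcon
  push Not at hcon
  have h1 : 1 ≤ Real.exp (δ * t) := Real.one_le_exp (by positivity)
  have h2 : E 0 ≤ |E 0| := le_abs_self _
  have h3 := abs_nonneg (E 0)
  nlinarith

lemma osc {a b : ℝ} (hab : a ≤ b) {f f' : ℝ → ℝ}
    (hd : ∀ x ∈ Set.Icc a b, HasDerivAt f (f' x) x) (hc : ContinuousOn f' (Set.Icc a b))
    {x y : ℝ} (hx : x ∈ Set.Icc a b) (hy : y ∈ Set.Icc a b) :
    f x - f y ≤ ∫ z in a..b, |f' z| := by
  have hsub : Set.uIcc y x ⊆ Set.Icc a b := Set.uIcc_subset_Icc hy hx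
  have h1 := intervalIntegral.integral_eq_sub_of_hasDerivAt (a := y) (b := x)
    (fun z hz => hd z (hsub hz)) ((hc.mono hsub).intervalIntegrable)
  rw [← h1]
  refine (le_abs_self _).trans ?_
  have h2 := intervalIntegral.norm_integral_le_integral_norm_uIoc (f := f') (a := y) (b := x)
    (μ := volume)
  rw [Real.norm_eq_abs] at h2
  refine h2.trans ?_
  rw [intervalIntegral.integral_of_le hab]
  refine setIntegral_mono_set ?_ (Filter.Eventually.of_forall fun _ => norm_nonneg _) ?_
  · exact (hc.abs.integrableOn_Icc).mono_set Set.Ioc_subset_Icc_self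
  · refine Filter.Eventually.of_forall ?_
    intro z hz
    have hz' : z ∈ Set.uIoc y x := hz
    rw [Set.mem_uIoc] at hz'
    rcases hz' with h | h
    · exact ⟨lt_of_le_of_lt hy.1 h.1, h.2.trans hx.2⟩
    · exact ⟨lt_of_le_of_lt hx.1 h.1, h.2.trans hy.2⟩

lemma neglog {a b c0 : ℝ} (hab : a < b) (hc0 : 0 < c0) {g g' β : ℝ → ℝ}
    (hpos : ∀ x ∈ Set.Icc a b, 0 < g x)
    (hd : ∀ x ∈ Set.Icc a b, HasDerivAt g (g' x) x) (hc : ContinuousOn g' (Set.Icc a b))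
    (hβ : ContinuousOn β (Set.Icc a b)) (hβ0 : ∀ x, 0 ≤ β x) (hβc : c0 ≤ ∫ x in a..b, β x) :
    -(∫ x in a..b, Real.log (g x)) ≤ (b - a) / c0 * (∫ x in a..b, β x / g x)
      + (b - a) * ((∫ x in a..b, (g' x / g x) ^ 2) + (b - a)) / 2 := by
  have hl : 0 < b - a := sub_pos.2 hab
  have hg : ContinuousOn g (Set.Icc a b) := fun x hx => (hd x hx).continuousAt.continuousWithinAt
  have hne : ∀ x ∈ Set.Icc a b, g x ≠ 0 := fun x hx => (hpos x hx).ne'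
  have hq : ContinuousOn (fun x => g' x / g x) (Set.Icc a b) := hc.div hg hne
  have hlog : ContinuousOn (fun x => Real.log (g x)) (Set.Icc a b) := hg.log hne
  have hbg : ContinuousOn (fun x => β x / g x) (Set.Icc a b) := hβ.div hg hne
  set O := ∫ z in a..b, |g' z / g z| with hO
  set W := ∫ x in a..b, β x / g x with hW
  have hW0 : 0 ≤ W := intervalIntegral.integral_nonneg hab.le
    (fun x hx => div_nonneg (hβ0 x) (hpos x hx).le)
  have hO1 : O ≤ ((∫ x in a..b, (g' x / g x) ^ 2) + (b - a)) / 2 := by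
    have : ∫ x in a..b, ((g' x / g x) ^ 2 + 1) / 2
        = ((∫ x in a..b, (g' x / g x) ^ 2) + (b - a)) / 2 := by
      rw [intervalIntegral.integral_div, intervalIntegral.integral_add
        (ii_of_cont hab.le (hq.fun_pow 2)) intervalIntegrable_const]
      simp
    rw [← this]
    refine intervalIntegral.integral_mono_on hab.le (ii_of_cont hab.le hq.abs)
      (ii_of_cont hab.le (((hq.fun_pow 2).add continuousOn_const).div_const 2)) (fun x _ => ?_)
    nlinarith [sq_nonneg (|g' x / g x| - 1), sq_abs (g' x / g x)]
  have key : ∀ y ∈ Set.Icc a b, -Real.log (g y) ≤ W / c0 + O := by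
    intro y hy
    have h1 : ∀ x ∈ Set.Icc a b, β x * (-Real.log (g y) - O) ≤ β x / g x := by
      intro x hx
      have h2 := osc hab.le (f := fun x => Real.log (g x)) (f' := fun x => g' x / g x)
        (fun x hx => (hd x hx).log (hne x hx)) hq hx hy
      have h3 : -Real.log (g x) ≤ 1 / g x := by
        have := Real.log_le_sub_one_of_pos (inv_pos.2 (hpos x hx))
        rw [Real.log_inv] at this
        rw [one_div]; linarith
      have h2' : Real.log (g x) - Real.log (g y) ≤ O := h2
      rw [div_eq_mul_one_div]
      exact mul_le_mul_of_nonneg_left (by linarith) (hβ0 x)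
    have h2 := intervalIntegral.integral_mono_on hab.le
      (ii_of_cont hab.le (hβ.fun_mul continuousOn_const)) (ii_of_cont hab.le hbg) h1
    rw [intervalIntegral.integral_mul_const] at h2
    have h2' : (∫ x in a..b, β x) * (-Real.log (g y) - O) ≤ W := h2
    by_cases hz : -Real.log (g y) - O ≤ 0
    · have : 0 ≤ W / c0 := div_nonneg hW0 hc0.le
      linarith
    · push Not at hz
      have : -Real.log (g y) - O ≤ W / c0 := by
        rw [le_div_iff₀ hc0]
        nlinarith
      linarith
  have h3 := intervalIntegral.integral_mono_on hab.le (ii_of_cont hab.le hlog.fun_neg)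
      (intervalIntegrable_const (c := W / c0 + O)) key
  rw [intervalIntegral.integral_neg, intervalIntegral.integral_const, smul_eq_mul] at h3
  refine h3.trans ?_
  have : (b - a) * O ≤ (b - a) * (((∫ x in a..b, (g' x / g x) ^ 2) + (b - a)) / 2) :=
    mul_le_mul_of_nonneg_left hO1 hl.le
  calc (b - a) * (W / c0 + O) = (b - a) / c0 * W + (b - a) * O := by ring
    _ ≤ _ := by linarith

lemma nonlocal {a b K : ℝ} (hab : a < b) (hK : 0 < K) {g g' : ℝ → ℝ}
    (hpos : ∀ x ∈ Set.Icc a b, 0 < g x)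
    (hd : ∀ x ∈ Set.Icc a b, HasDerivAt g (g' x) x) (hc : ContinuousOn g' (Set.Icc a b))
    (hKg : ∫ x in a..b, (1 + g x) ≤ K) :
    ∫ x in a..b, (1 + g x) ^ 2 ≤ 2 * K ^ 2 / (b - a)
      + K ^ 2 * ∫ x in a..b, (g' x / (1 + g x)) ^ 2 := by
  have hl : 0 < b - a := sub_pos.2 hab
  have hg : ContinuousOn g (Set.Icc a b) := fun x hx => (hd x hx).continuousAt.continuousWithinAt
  have hg1 : ContinuousOn (fun x => 1 + g x) (Set.Icc a b) := continuousOn_const.fun_add hg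
  have hne : ∀ x ∈ Set.Icc a b, 1 + g x ≠ 0 := fun x hx => by have := hpos x hx; positivity
  have hq : ContinuousOn (fun x => g' x / (1 + g x)) (Set.Icc a b) := hc.div hg1 hne
  set O := ∫ z in a..b, |g' z| with hO
  set N := ∫ x in a..b, (1 + g x) ^ 2 with hN
  set D := ∫ x in a..b, (g' x / (1 + g x)) ^ 2 with hD
  have hO0 : 0 ≤ O := intervalIntegral.integral_nonneg hab.le (fun x _ => abs_nonneg _)
  have hO1 : O ≤ K / 2 * D + 1 / (2 * K) * N := by
    rw [hD, hN, ← intervalIntegral.integral_const_mul, ← intervalIntegral.integral_const_mul,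
      ← intervalIntegral.integral_add (ii_of_cont hab.le (continuousOn_const.fun_mul (hq.fun_pow 2)))
        (ii_of_cont hab.le (continuousOn_const.fun_mul (hg1.fun_pow 2)))]
    refine intervalIntegral.integral_mono_on hab.le (ii_of_cont hab.le hc.abs)
      (ii_of_cont hab.le ((continuousOn_const.fun_mul (hq.fun_pow 2)).add
        (continuousOn_const.fun_mul (hg1.fun_pow 2)))) (fun x hx => ?_)
    have hp := hpos x hx
    have h1 : |g' x| = |g' x / (1 + g x)| * (1 + g x) := by
      rw [abs_div, abs_of_pos (show 0 < 1 + g x by linarith), div_mul_cancel₀ _ (hne x hx)]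
    rw [h1, ← sq_abs (g' x / (1 + g x))]
    set r := |g' x / (1 + g x)|
    set z := 1 + g x
    have : K / 2 * r ^ 2 + 1 / (2 * K) * z ^ 2 - r * z = (K * r - z) ^ 2 / (2 * K) := by
      field_simp; ring
    have h3 : 0 ≤ (K * r - z) ^ 2 / (2 * K) := by positivity
    linarith
  have key : ∀ x ∈ Set.Icc a b, (b - a) * (1 + g x) ^ 2 ≤ (K + (b - a) * O) * (1 + g x) := by
    intro x hx
    have h2 : (b - a) * (1 + g x) ≤ K + (b - a) * O := by
      have h3 := intervalIntegral.integral_mono_on hab.le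
        (intervalIntegrable_const (c := 1 + g x))
        (ii_of_cont hab.le (hg1.fun_add (continuousOn_const (c := O))))
        (fun y hy => by
          have := osc hab.le hd hc hx hy
          show 1 + g x ≤ 1 + g y + O
          linarith)
      rw [intervalIntegral.integral_const, smul_eq_mul] at h3
      have h4 : ∫ y in a..b, (1 + g y + O) = (∫ y in a..b, (1 + g y)) + (b - a) * O := by
        rw [intervalIntegral.integral_add (ii_of_cont hab.le hg1) intervalIntegrable_const]
        simp
      have h5 : (b - a) * (1 + g x) ≤ ∫ y in a..b, (1 + g y + O) := h3
      linarith
    have := hpos x hx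
    nlinarith
  have h3 := intervalIntegral.integral_mono_on hab.le
    (ii_of_cont hab.le (continuousOn_const.fun_mul (hg1.fun_pow 2)))
    (ii_of_cont hab.le (continuousOn_const.fun_mul hg1)) key
  rw [intervalIntegral.integral_const_mul, intervalIntegral.integral_const_mul] at h3
  have h4 : (b - a) * N ≤ (K + (b - a) * O) * K :=
    h3.trans (mul_le_mul_of_nonneg_left hKg (by positivity))
  have h5 : (b - a) * O * K ≤ (b - a) * (K / 2 * D + 1 / (2 * K) * N) * K := by gcongr
  have h6 : (b - a) * (K / 2 * D + 1 / (2 * K) * N) * K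
      = (b - a) * (K ^ 2 * D) / 2 + (b - a) * N / 2 := by
    field_simp
  have h7 : (b - a) * N ≤ (b - a) * (2 * K ^ 2 / (b - a) + K ^ 2 * D) := by
    have : (b - a) * (2 * K ^ 2 / (b - a) + K ^ 2 * D)
      = 2 * K ^ 2 + (b - a) * (K ^ 2 * D) := by field_simp
    rw [this]; nlinarith
  exact le_of_mul_le_mul_left h7 hl

lemma quad {α β γ : ℝ} (hα : 0 < α) (hγ : 0 < γ) (h : β ^ 2 < 4 * α * γ) :
    ∃ c : ℝ, 0 < c ∧ ∀ r s : ℝ, c * (r ^ 2 + s ^ 2) ≤ α * r ^ 2 - β * r * s + γ * s ^ 2 := by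
  have hs : 0 < α + γ := by linarith
  set c := (4 * α * γ - β ^ 2) / (4 * (α + γ)) with hcdef
  have hc : 0 < c := div_pos (by linarith) (by linarith)
  have hc4 : c * (4 * (α + γ)) = 4 * α * γ - β ^ 2 := by
    rw [hcdef]; field_simp
  have hca : 0 < α - c := by
    have : c * (α + γ) ≤ α * γ := by nlinarith [sq_nonneg β]
    nlinarith
  refine ⟨c, hc, fun r s => ?_⟩
  have h1 : 0 ≤ 4 * (α - c) * (α * r ^ 2 - β * r * s + γ * s ^ 2 - c * (r ^ 2 + s ^ 2)) := by
    have : 4 * (α - c) * (α * r ^ 2 - β * r * s + γ * s ^ 2 - c * (r ^ 2 + s ^ 2))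
      = (2 * (α - c) * r - β * s) ^ 2
        + (4 * α * γ - β ^ 2 - c * (4 * (α + γ)) + 4 * c ^ 2) * s ^ 2 := by ring
    rw [this, hc4]
    have : 0 ≤ (4 * α * γ - β ^ 2 - (4 * α * γ - β ^ 2) + 4 * c ^ 2) := by nlinarith
    positivity
  have h2 := nonneg_of_mul_nonneg_right h1 (by linarith)
  linarith

lemma quad_form {χ p q : ℝ} (hχ : 0 < χ) (hp : p ∈ Set.Ioo (0:ℝ) 1) (hpχ : p < 1 / χ^2)
    (hq : q ∈ Set.Ioo (qminus χ p) (qplus χ p)) :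
    0 < q ∧ p + q < 1 ∧ ∃ c : ℝ, 0 < c ∧ ∀ r s : ℝ, c * (r ^ 2 + s ^ 2) ≤
      p * (1 - p) * r ^ 2 - p * (2 * q + (1 - p) * χ) * r * s + q * (1 - q + p * χ) * s ^ 2 := by
  obtain ⟨hp0, hp1⟩ := hp
  have h1 : p * χ ^ 2 < 1 := by rwa [lt_div_iff₀ (by positivity)] at hpχ
  have hσ2 : Real.sqrt (1 - p * χ ^ 2) ^ 2 = 1 - p * χ ^ 2 := Real.sq_sqrt (by linarith)
  have hσ0 : 0 ≤ Real.sqrt (1 - p * χ ^ 2) := Real.sqrt_nonneg _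
  have hpx : 0 < p * χ ^ 2 := by positivity
  obtain ⟨hq1, hq2⟩ := hq
  unfold qminus at hq1
  unfold qplus at hq2
  set σ := Real.sqrt (1 - p * χ ^ 2)
  have hσ1 : σ ≤ 1 := by nlinarith
  have hq0 : 0 < q := lt_of_le_of_lt (mul_nonneg (by linarith) (by linarith)) hq1
  have hpq : p + q < 1 := by nlinarith
  refine ⟨hq0, hpq, quad (mul_pos hp0 (by linarith)) (mul_pos hq0 (by nlinarith)) ?_⟩
  have h3 : (2 * q - (1 - p)) ^ 2 < (1 - p) ^ 2 * (1 - p * χ ^ 2) := by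
    rw [← hσ2]
    nlinarith
  have h4 : 4 * (p * (1 - p)) * (q * (1 - q + p * χ)) - (p * (2 * q + (1 - p) * χ)) ^ 2
     = p * ((1 - p) ^ 2 * (1 - p * χ ^ 2) - (2 * q - (1 - p)) ^ 2) := by ring
  have h5 : 0 < p * ((1 - p) ^ 2 * (1 - p * χ ^ 2) - (2 * q - (1 - p)) ^ 2) :=
    mul_pos hp0 (by linarith)
  linarith

section sol2

variable {a b χ : ℝ} {B1 B2 : ℝ → ℝ → ℝ} {u0 v0 : ℝ → ℝ} {u v : ℝ → ℝ → ℝ} {Tmax : ℝ≥0∞}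

lemma chain_const (c : ℝ) : ChainR (fun _ _ => c) (fun _ _ => 0) (fun _ _ => 0) := by
  intro f g f' g' s _ _ _ _
  simpa using hasDerivAt_const s c

lemma contQ_const (c : ℝ) : ContQ (fun _ _ => c) := continuousOn_const

lemma CrimeSol.slice_u (hsol : CrimeSol a b χ B1 B2 u0 v0 u v Tmax) {t : ℝ} (ht : t ∈ It Tmax) :
    ContinuousOn (fun x => u x t) (Set.Icc a b) := cont_slice hsol.u_cont ht

lemma CrimeSol.slice_v (hsol : CrimeSol a b χ B1 B2 u0 v0 u v Tmax) {t : ℝ} (ht : t ∈ It Tmax) :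
    ContinuousOn (fun x => v x t) (Set.Icc a b) := cont_slice hsol.v_cont ht

lemma CrimeSol.slice_vx (hsol : CrimeSol a b χ B1 B2 u0 v0 u v Tmax) {t : ℝ}
    (ht : t ∈ It' Tmax) : ContinuousOn (fun x => pdx v x t) (Set.Icc a b) := by
  have hvx : ContinuousOn (fun z : ℝ × ℝ => pdx v z.1 z.2) (Set.Icc a b ×ˢ It' Tmax) :=
    continuous_fst.comp_continuousOn hsol.v_cont21
  exact cont_slice hvx ht

/-- derivative of `∫ u + v` -/
lemma CrimeSol.deriv_uv (hab : a < b) (hB1 : HypB a b B1) (hB2 : HypB a b B2)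
    (hsol : CrimeSol a b χ B1 B2 u0 v0 u v Tmax) {t : ℝ} (ht : t ∈ It' Tmax) :
    HasDerivAt (fun s => ∫ x in a..b, (u x s + v x s))
      (∫ x in a..b, (B1 x t + B2 x t - v x t)) t := by
  have h := (hsol.functional hab hB1 hB2 (G := fun X Y => X + Y) (Gu := fun _ _ => 1)
    (Gv := fun _ _ => 1) (Guu := fun _ _ => 0) (Guv := fun _ _ => 0) (Gvv := fun _ _ => 0)
    (continuous_fst.add continuous_snd).continuousOn (contQ_const 1) (contQ_const 1)
    (contQ_const 0) (contQ_const 0) (contQ_const 0)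
    (by intro f g f' g' s _ _ hf hg; simpa using hf.fun_add hg)
    (chain_const 1) (chain_const 1) ht).2
  convert h using 2
  funext x
  simp only [Igd]
  ring

lemma CrimeSol.deriv_u (hab : a < b) (hB1 : HypB a b B1) (hB2 : HypB a b B2)
    (hsol : CrimeSol a b χ B1 B2 u0 v0 u v Tmax) {t : ℝ} (ht : t ∈ It' Tmax) :
    HasDerivAt (fun s => ∫ x in a..b, u x s)
      (∫ x in a..b, (B1 x t - u x t * v x t)) t := by
  have h := (hsol.functional hab hB1 hB2 (G := fun X _ => X) (Gu := fun _ _ => 1)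
    (Gv := fun _ _ => 0) (Guu := fun _ _ => 0) (Guv := fun _ _ => 0) (Gvv := fun _ _ => 0)
    continuous_fst.continuousOn (contQ_const 1) (contQ_const 0)
    (contQ_const 0) (contQ_const 0) (contQ_const 0)
    (by intro f g f' g' s _ _ hf hg; simpa using hf)
    (chain_const 1) (chain_const 0) ht).2
  convert h using 2
  funext x
  simp only [Igd]
  ring

lemma CrimeSol.deriv_log (hab : a < b) (hB1 : HypB a b B1) (hB2 : HypB a b B2)
    (hsol : CrimeSol a b χ B1 B2 u0 v0 u v Tmax) {t : ℝ} (ht : t ∈ It' Tmax) :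
    HasDerivAt (fun s => ∫ x in a..b, (u x s + v x s - 1 / 2 * Real.log (v x s)))
      (∫ x in a..b, (-(1 / 2) * (pdx v x t / v x t) ^ 2 + (B1 x t + B2 x t) - v x t
        - 1 / 2 * u x t + 1 / 2 - 1 / 2 * (B2 x t / v x t))) t := by
  have c0 : ContinuousOn (fun z : ℝ × ℝ => z.2) (Set.Ioi (0:ℝ) ×ˢ Set.Ioi (0:ℝ)) :=
    continuous_snd.continuousOn
  have cne : ∀ z ∈ (Set.Ioi (0:ℝ) ×ˢ Set.Ioi (0:ℝ)), (z : ℝ × ℝ).2 ≠ 0 := fun z hz =>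
    (show (0:ℝ) < z.2 from hz.2).ne'
  have c2 : ContQ (fun _ Y => 1 / 2 * (1 / Y ^ 2)) := by
    have h1 : ContinuousOn (fun z : ℝ × ℝ => z.2 ^ 2) (Set.Ioi (0:ℝ) ×ˢ Set.Ioi (0:ℝ)) :=
      c0.fun_pow 2
    have h2 : ContinuousOn (fun z : ℝ × ℝ => 1 / z.2 ^ 2) (Set.Ioi (0:ℝ) ×ˢ Set.Ioi (0:ℝ)) :=
      continuousOn_const.div h1 (fun z hz => pow_ne_zero 2 (cne z hz))
    exact continuousOn_const.fun_mul h2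
  have h := (hsol.functional hab hB1 hB2 (G := fun X Y => X + Y - 1 / 2 * Real.log Y)
    (Gu := fun _ _ => 1) (Gv := fun _ Y => 1 - 1 / 2 * (1 / Y))
    (Guu := fun _ _ => 0) (Guv := fun _ _ => 0) (Gvv := fun _ Y => 1 / 2 * (1 / Y ^ 2))
    ((continuous_fst.add continuous_snd).continuousOn.sub (continuousOn_const.mul (c0.log cne)))
    (contQ_const 1)
    (continuousOn_const.sub (continuousOn_const.mul (continuousOn_const.div c0 cne)))
    (contQ_const 0) (contQ_const 0)
    c2
    (by
      intro f g f' g' s _ hg0 hf hg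
      refine ((hf.fun_add hg).fun_sub ((hg.log hg0.ne').const_mul (1 / 2))).congr_deriv ?_
      ring)
    (chain_const 1)
    (by
      intro f g f' g' s _ hg0 hf hg
      refine ((((hasDerivAt_const s (1:ℝ)).fun_div hg hg0.ne').const_mul
        (1 / 2)).const_sub 1).congr_deriv ?_
      field_simp
      ring) ht).2
  rw [intervalIntegral.integral_congr] at h
  · exact h
  · intro x hx
    rw [Set.uIcc_of_le hab.le] at hx
    have := hsol.v_pos x hx t ht
    simp only [Igd]
    field_simp
    ring

lemma CrimeSol.cont_uv (hab : a < b)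
    (hsol : CrimeSol a b χ B1 B2 u0 v0 u v Tmax) :
    ContinuousOn (fun s => ∫ x in a..b, (u x s + v x s)) (It Tmax) :=
  cont_param hab.le (f := fun x s => u x s + v x s) (hsol.u_cont.add hsol.v_cont)

lemma HypB.int_le {B : ℝ → ℝ → ℝ} (hab : a < b) (h : HypB a b B) {M : ℝ} (hM : ∀ x t, B x t ≤ M)
    {t : ℝ} (ht : 0 ≤ t) : ∫ x in a..b, B x t ≤ M * (b - a) := by
  have := intervalIntegral.integral_mono_on hab.le
    (ii_of_cont hab.le (cont_slice h.cont (t := t) ht)) (intervalIntegrable_const (c := M))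
    (fun x _ => hM x t)
  simpa [mul_comm] using this

lemma mass1 (hab : a < b) (hB1 : HypB a b B1) (hB2 : HypB a b B2)
    (hsol : CrimeSol a b χ B1 B2 u0 v0 u v Tmax) (T : ℝ) :
    ∃ m : ℝ, ∀ t ∈ It' Tmax, t ≤ T → ∫ x in a..b, (u x t + v x t) ≤ m := by
  obtain ⟨M1, hM1⟩ := hB1.2.1
  obtain ⟨M2, hM2⟩ := hB2.2.1
  have hM1' : 0 ≤ M1 := (hB1.1 0 0).trans (hM1 0 0)
  have hM2' : 0 ≤ M2 := (hB2.1 0 0).trans (hM2 0 0)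
  have hl : 0 < b - a := sub_pos.2 hab
  refine ⟨(∫ x in a..b, (u x 0 + v x 0)) + (M1 + M2) * (b - a) * T, fun t ht htT => ?_⟩
  have h := intervalIntegral.sub_le_integral_of_hasDeriv_right_of_le
    (φ := fun _ => (M1 + M2) * (b - a)) (g := fun s => ∫ x in a..b, (u x s + v x s))
    (g' := fun s => ∫ x in a..b, (B1 x s + B2 x s - v x s)) ht.1.le
    ((hsol.cont_uv hab).mono (Icc_sub_It ht.2))
    (fun s hs => (hsol.deriv_uv hab hB1 hB2
      ⟨hs.1, (Icc_sub_It ht.2 (Set.Ioo_subset_Icc_self hs)).2⟩).hasDerivWithinAt)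
    continuousOn_const.integrableOn_Icc (fun s hs => by
      have hs' : s ∈ It' Tmax := ⟨hs.1, (Icc_sub_It ht.2 (Set.Ioo_subset_Icc_self hs)).2⟩
      have h1 := intervalIntegral.integral_mono_on hab.le
        (ii_of_cont hab.le (((cont_slice hB1.cont (t := s) hs.1.le).fun_add
          (cont_slice hB2.cont (t := s) hs.1.le)).fun_sub (hsol.slice_v (It'_sub _ hs'))))
        (intervalIntegrable_const (c := M1 + M2))
        (fun x hx => by linarith [hM1 x s, hM2 x s, hsol.v_pos x hx s hs'])
      simpa [mul_comm, add_mul, mul_add] using h1)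
  simp only [intervalIntegral.integral_const, smul_eq_mul, sub_zero] at h
  have : t * ((M1 + M2) * (b - a)) ≤ T * ((M1 + M2) * (b - a)) := by gcongr
  linarith

lemma mass_of_u (hab : a < b) (hB1 : HypB a b B1) (hB2 : HypB a b B2)
    (hsol : CrimeSol a b χ B1 B2 u0 v0 u v Tmax) (mu : ℝ) (hmu : 0 ≤ mu)
    (hU : ∀ t ∈ It' Tmax, ∫ x in a..b, u x t ≤ mu) :
    ∃ m : ℝ, ∀ t ∈ It' Tmax, ∫ x in a..b, (u x t + v x t) ≤ m := by
  obtain ⟨M1, hM1⟩ := hB1.2.1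
  obtain ⟨M2, hM2⟩ := hB2.2.1
  have hM1' : 0 ≤ M1 := (hB1.1 0 0).trans (hM1 0 0)
  have hM2' : 0 ≤ M2 := (hB2.1 0 0).trans (hM2 0 0)
  have hl : 0 < b - a := sub_pos.2 hab
  refine ⟨_, fun t ht => gron (E := fun s => ∫ x in a..b, (u x s + v x s))
    (E' := fun s => ∫ x in a..b, (B1 x s + B2 x s - v x s))
    (K := M1 * (b - a) + M2 * (b - a) + mu) one_pos (by positivity) ht.1.le
    ((hsol.cont_uv hab).mono (Icc_sub_It ht.2)) (fun s hs => (hsol.deriv_uv hab hB1 hB2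
      ⟨hs.1, (Icc_sub_It ht.2 (Set.Ioo_subset_Icc_self hs)).2⟩)) (fun s hs => ?_)⟩
  have hs' : s ∈ It' Tmax := ⟨hs.1, (Icc_sub_It ht.2 (Set.Ioo_subset_Icc_self hs)).2⟩
  have i1 := ii_of_cont hab.le (cont_slice hB1.cont (t := s) hs.1.le)
  have i2 := ii_of_cont hab.le (cont_slice hB2.cont (t := s) hs.1.le)
  have i3 := ii_of_cont hab.le (hsol.slice_u (It'_sub _ hs'))
  have i4 := ii_of_cont hab.le (hsol.slice_v (It'_sub _ hs'))
  have := hU s hs'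
  have := hB1.int_le hab hM1 hs.1.le
  have := hB2.int_le hab hM2 hs.1.le
  rw [intervalIntegral.integral_sub (i1.add i2) i4, intervalIntegral.integral_add i1 i2,
    intervalIntegral.integral_add i3 i4]
  linarith

lemma mass_H1 (hab : a < b) (hB1 : HypB a b B1) (hB2 : HypB a b B2)
    (hsol : CrimeSol a b χ B1 B2 u0 v0 u v Tmax) (hinit : HypInit a b u0 v0)
    (h1 : HypH1 a b B1) :
    ∃ m : ℝ, ∀ t ∈ It' Tmax, ∫ x in a..b, (u x t + v x t) ≤ m := by
  have hJ0 : 0 ≤ ∫ z in (Set.Ioo a b) ×ˢ (Set.Ioi (0:ℝ)), B1 z.1 z.2 :=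
    integral_nonneg (fun z => hB1.1 _ _)
  have hU0 : 0 ≤ ∫ x in a..b, u x 0 := intervalIntegral.integral_nonneg hab.le
    (fun x hx => by rw [hsol.u_init x hx]; exact hinit.2.1 x hx)
  refine mass_of_u hab hB1 hB2 hsol
    ((∫ x in a..b, u x 0) + ∫ z in (Set.Ioo a b) ×ˢ (Set.Ioi (0:ℝ)), B1 z.1 z.2)
    (by positivity) (fun t ht => ?_)
  have hβ : ContinuousOn (fun s => ∫ x in a..b, B1 x s) (Set.Ici 0) := cont_param hab.le hB1.cont
  have h := intervalIntegral.sub_le_integral_of_hasDeriv_right_of_le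
    (φ := fun s => ∫ x in a..b, B1 x s) (g := fun s => ∫ x in a..b, u x s)
    (g' := fun s => ∫ x in a..b, (B1 x s - u x s * v x s)) ht.1.le
    ((cont_param hab.le hsol.u_cont).mono (Icc_sub_It ht.2))
    (fun s hs => (hsol.deriv_u hab hB1 hB2
      ⟨hs.1, (Icc_sub_It ht.2 (Set.Ioo_subset_Icc_self hs)).2⟩).hasDerivWithinAt)
    ((hβ.mono Set.Icc_subset_Ici_self).integrableOn_Icc) (fun s hs => by
      have hs' : s ∈ It' Tmax := ⟨hs.1, (Icc_sub_It ht.2 (Set.Ioo_subset_Icc_self hs)).2⟩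
      have sB := cont_slice hB1.cont (t := s) hs.1.le
      exact intervalIntegral.integral_mono_on hab.le
        (ii_of_cont hab.le (sB.fun_sub
          ((hsol.slice_u (It'_sub _ hs')).fun_mul (hsol.slice_v (It'_sub _ hs')))))
        (ii_of_cont hab.le sB)
        (fun x hx => by nlinarith [mul_pos (hsol.u_pos x hx s hs') (hsol.v_pos x hx s hs')]))
  have hfub : ∫ s in (0:ℝ)..t, ∫ x in a..b, B1 x s
      ≤ ∫ z in (Set.Ioo a b) ×ˢ (Set.Ioi (0:ℝ)), B1 z.1 z.2 := by
    have hsub : (Set.Ioo a b) ×ˢ (Set.Ioc 0 t) ⊆ (Set.Ioo a b) ×ˢ (Set.Ioi (0:ℝ)) :=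
      Set.prod_mono_right Set.Ioc_subset_Ioi_self
    have h1' : IntegrableOn (fun z : ℝ × ℝ => B1 z.1 z.2) ((Set.Ioo a b) ×ˢ (Set.Ioc 0 t)) :=
      IntegrableOn.mono_set h1 hsub
    have e : ∫ s in (0:ℝ)..t, ∫ x in a..b, B1 x s
        = ∫ z in (Set.Ioo a b) ×ˢ (Set.Ioc 0 t), B1 z.1 z.2 := by
      rw [Measure.volume_eq_prod] at h1' ⊢
      rw [← setIntegral_prod_swap, setIntegral_prod
        (fun z : ℝ × ℝ => B1 z.swap.1 z.swap.2) h1'.swap,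
        intervalIntegral.integral_of_le ht.1.le]
      refine setIntegral_congr_fun measurableSet_Ioc (fun s _ => ?_)
      simp only [intervalIntegral.integral_of_le hab.le, integral_Ioc_eq_integral_Ioo, Prod.swap]
    rw [e]
    exact setIntegral_mono_set h1 (Filter.Eventually.of_forall fun z => hB1.1 _ _)
      (Filter.Eventually.of_forall hsub)
  linarith

lemma mass_H2 (hab : a < b) (hB1 : HypB a b B1) (hB2 : HypB a b B2)
    (hsol : CrimeSol a b χ B1 B2 u0 v0 u v Tmax) (hinit : HypInit a b u0 v0)
    (h2 : HypH2 a b B2) :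
    ∃ m : ℝ, ∀ t ∈ It' Tmax, ∫ x in a..b, (u x t + v x t) ≤ m := by
  obtain ⟨M1, hM1⟩ := hB1.2.1
  obtain ⟨M2, hM2⟩ := hB2.2.1
  obtain ⟨c0, hc0, hc⟩ := h2
  have hM1' : 0 ≤ M1 := (hB1.1 0 0).trans (hM1 0 0)
  have hM2' : 0 ≤ M2 := (hB2.1 0 0).trans (hM2 0 0)
  have hl : 0 < b - a := sub_pos.2 hab
  have hvpos : ∀ x ∈ Set.Icc a b, ∀ t ∈ It Tmax, 0 < v x t := by
    intro x hx t ht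
    rcases ht.1.eq_or_lt with h | h
    · rw [← h, hsol.v_init x hx]; exact hinit.2.2.2 x hx
    · exact hsol.v_pos x hx t ⟨h, ht.2⟩
  have hEc : ContinuousOn (fun s => ∫ x in a..b, (u x s + v x s - 1 / 2 * Real.log (v x s)))
      (It Tmax) := cont_param hab.le (f := fun x s => u x s + v x s - 1 / 2 * Real.log (v x s))
        ((hsol.u_cont.add hsol.v_cont).sub (continuousOn_const.mul
          (hsol.v_cont.log (fun z hz => (hvpos _ hz.1 _ hz.2).ne'))))
  set δ : ℝ := 1 / (2 + (b - a) / c0 + (b - a)) with hδ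
  have hden : 0 < 2 + (b - a) / c0 + (b - a) := by positivity
  have hδ0 : 0 < δ := by positivity
  have hδe : δ * (2 + (b - a) / c0 + (b - a)) = 1 := by rw [hδ]; field_simp
  have hq0 : 0 < (b - a) / c0 := by positivity
  have d1 : δ * 2 ≤ 1 := by nlinarith
  have d2 : δ * ((b - a) / c0) ≤ 1 := by nlinarith
  have d3 : δ * (b - a) ≤ 1 := by nlinarith
  have hb := fun t (ht : t ∈ It' Tmax) =>
    gron (E := fun s => ∫ x in a..b, (u x s + v x s - 1 / 2 * Real.log (v x s)))
    (K := M1 * (b - a) + M2 * (b - a) + 1 / 2 * (b - a) + δ * (b - a) ^ 2 / 4) hδ0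
    (by positivity) ht.1.le (hEc.mono (Icc_sub_It ht.2))
    (fun s hs => (hsol.deriv_log hab hB1 hB2
      ⟨hs.1, (Icc_sub_It ht.2 (Set.Ioo_subset_Icc_self hs)).2⟩)) (fun s hs => by
      have hs' : s ∈ It' Tmax := ⟨hs.1, (Icc_sub_It ht.2 (Set.Ioo_subset_Icc_self hs)).2⟩
      have hne : ∀ x ∈ Set.Icc a b, v x s ≠ 0 := fun x hx => (hsol.v_pos x hx s hs').ne'
      have sB1 := cont_slice hB1.cont (t := s) hs.1.le
      have sB2 := cont_slice hB2.cont (t := s) hs.1.le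
      have sv := hsol.slice_v (It'_sub _ hs')
      have svx := hsol.slice_vx hs'
      have i1 := ii_of_cont hab.le sB1
      have i2 := ii_of_cont hab.le sB2
      have i3 := ii_of_cont hab.le (hsol.slice_u (It'_sub _ hs'))
      have i4 := ii_of_cont hab.le sv
      have i5 := ii_of_cont hab.le (sv.log hne)
      have s6 : ContinuousOn (fun x => pdx v x s / v x s) (Set.Icc a b) := svx.div sv hne
      have s7 : ContinuousOn (fun x => B2 x s / v x s) (Set.Icc a b) := sB2.div sv hne
      have i6 := ii_of_cont hab.le (s6.fun_pow 2)
      have i7 := ii_of_cont hab.le s7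
      have hβc : c0 ≤ ∫ x in a..b, B2 x s := by
        rw [intervalIntegral.integral_of_le hab.le, integral_Ioc_eq_integral_Ioo]
        exact hc s hs.1
      have hnl := neglog hab hc0 (g := fun x => v x s) (g' := fun x => pdx v x s)
        (β := fun x => B2 x s) (fun x hx => hsol.v_pos x hx s hs')
        (fun x hx => (hsol.v_reg x hx s hs').1.hasDerivAt) svx sB2 (fun x => hB2.1 x s) hβc
      have b1 := hB1.int_le hab hM1 hs.1.le
      have b2 := hB2.int_le hab hM2 hs.1.le
      have U0 : 0 ≤ ∫ x in a..b, u x s := intervalIntegral.integral_nonneg hab.le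
        (fun x hx => (hsol.u_pos x hx s hs').le)
      have V0 : 0 ≤ ∫ x in a..b, v x s := intervalIntegral.integral_nonneg hab.le
        (fun x hx => (hsol.v_pos x hx s hs').le)
      have W0 : 0 ≤ ∫ x in a..b, B2 x s / v x s := intervalIntegral.integral_nonneg hab.le
        (fun x hx => div_nonneg (hB2.1 x s) (hsol.v_pos x hx s hs').le)
      have D0 : 0 ≤ ∫ x in a..b, (pdx v x s / v x s) ^ 2 :=
        intervalIntegral.integral_nonneg hab.le (fun x hx => sq_nonneg _)
      rw [intervalIntegral.integral_sub (((((i6.const_mul _).add (i1.add i2)).sub i4).sub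
          (i3.const_mul _)).add intervalIntegrable_const) (i7.const_mul _),
        intervalIntegral.integral_add ((((i6.const_mul _).add (i1.add i2)).sub i4).sub
          (i3.const_mul _)) intervalIntegrable_const,
        intervalIntegral.integral_sub (((i6.const_mul _).add (i1.add i2)).sub i4)
          (i3.const_mul _),
        intervalIntegral.integral_sub ((i6.const_mul _).add (i1.add i2)) i4,
        intervalIntegral.integral_add (i6.const_mul _) (i1.add i2),
        intervalIntegral.integral_add i1 i2,
        intervalIntegral.integral_sub (i3.add i4) (i5.const_mul _),
        intervalIntegral.integral_add i3 i4]
      simp only [intervalIntegral.integral_const_mul, intervalIntegral.integral_const, smul_eq_mul]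
      set L := ∫ x in a..b, Real.log (v x s)
      set W := ∫ x in a..b, B2 x s / v x s
      set D := ∫ x in a..b, (pdx v x s / v x s) ^ 2
      set U := ∫ x in a..b, u x s
      set V := ∫ x in a..b, v x s
      have k1 : δ * (-L) ≤ δ * ((b - a) / c0 * W + (b - a) * (D + (b - a)) / 2) :=
        mul_le_mul_of_nonneg_left hnl hδ0.le
      have k2 : δ * ((b - a) / c0) * W ≤ 1 * W := mul_le_mul_of_nonneg_right d2 W0
      have k3 : δ * (b - a) * D ≤ 1 * D := mul_le_mul_of_nonneg_right d3 D0
      have k4 : δ * 2 * U ≤ 1 * U := mul_le_mul_of_nonneg_right d1 U0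
      have k5 : δ * 2 * V ≤ 1 * V := mul_le_mul_of_nonneg_right d1 V0
      nlinarith)
  refine ⟨2 * _, fun t ht => le_trans ?_ (mul_le_mul_of_nonneg_left (hb t ht) (by norm_num))⟩
  rw [← intervalIntegral.integral_const_mul]
  have su := hsol.slice_u (It'_sub _ ht)
  have sv := hsol.slice_v (It'_sub _ ht)
  refine intervalIntegral.integral_mono_on hab.le (ii_of_cont hab.le (su.fun_add sv))
    (ii_of_cont hab.le (continuousOn_const.fun_mul ((su.fun_add sv).fun_sub
      (continuousOn_const.fun_mul (sv.log fun x hx => (hsol.v_pos x hx t ht).ne')))))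
    (fun x hx => ?_)
  have p1 := hsol.u_pos x hx t ht
  have p2 := Real.log_le_sub_one_of_pos (hsol.v_pos x hx t ht)
  linarith

end sol2

section core

/-- the weight `X^p Y^q` -/
def Wt (p q X Y : ℝ) : ℝ := X ^ p * Y ^ q

lemma Wt_pos {p q X Y : ℝ} (hX : 0 < X) (hY : 0 < Y) : 0 < Wt p q X Y :=
  mul_pos (Real.rpow_pos_of_pos hX _) (Real.rpow_pos_of_pos hY _)

lemma Wt_le {p q X Y : ℝ} (hp : 0 < p) (hq : 0 < q) (hpq : p + q < 1) (hX : 0 < X) (hY : 0 < Y) :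
    Wt p q X Y ≤ 1 + X + Y := by
  have h := Real.geom_mean_le_arith_mean3_weighted hp.le hq.le
    (show 0 ≤ 1 - p - q by linarith) hX.le hY.le zero_le_one (by ring)
  rw [Real.one_rpow, mul_one] at h
  have h1 : p * X ≤ 1 * X := by gcongr; linarith
  have h2 : q * Y ≤ 1 * Y := by gcongr; linarith
  unfold Wt
  linarith

lemma Wt_cont (p q : ℝ) : ContQ (Wt p q) := by
  have h1 : ContinuousOn (fun z : ℝ × ℝ => z.1 ^ p) (Set.Ioi (0:ℝ) ×ˢ Set.Ioi (0:ℝ)) :=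
    continuous_fst.continuousOn.rpow_const
      (fun z hz => Or.inl (show (0:ℝ) < z.1 from hz.1).ne')
  have h2 : ContinuousOn (fun z : ℝ × ℝ => z.2 ^ q) (Set.Ioi (0:ℝ) ×ˢ Set.Ioi (0:ℝ)) :=
    continuous_snd.continuousOn.rpow_const
      (fun z hz => Or.inl (show (0:ℝ) < z.2 from hz.2).ne')
  exact h1.fun_mul h2

lemma Wt_chain (p q : ℝ) : ChainR (Wt p q) (fun X Y => p * Wt p q X Y / X)
    (fun X Y => q * Wt p q X Y / Y) := by
  intro f g f' g' s hf0 hg0 hf hg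
  refine ((hf.rpow_const (p := p) (Or.inl hf0.ne')).fun_mul
    (hg.rpow_const (p := q) (Or.inl hg0.ne'))).congr_deriv ?_
  rw [Real.rpow_sub_one hf0.ne', Real.rpow_sub_one hg0.ne']
  simp only [Wt]
  field_simp

variable {a b χ : ℝ} {B1 B2 : ℝ → ℝ → ℝ} {u0 v0 : ℝ → ℝ} {u v : ℝ → ℝ → ℝ} {Tmax : ℝ≥0∞}

lemma core_deriv (hab : a < b) (hB1 : HypB a b B1) (hB2 : HypB a b B2)
    (hsol : CrimeSol a b χ B1 B2 u0 v0 u v Tmax) (p q A : ℝ) {t : ℝ} (ht : t ∈ It' Tmax) :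
    ∃ I : ℝ → ℝ, ContinuousOn I (Set.Icc a b) ∧
      HasDerivAt (fun s => ∫ x in a..b, (Wt p q (u x s) (v x s) - p * u x s
        + A * Real.log (1 + v x s))) (∫ x in a..b, I x) t ∧
      ∀ x ∈ Set.Icc a b, I x = Wt p q (u x t) (v x t) *
          (p * (1 - p) * (pdx u x t / u x t) ^ 2
            - p * (2 * q + (1 - p) * χ) * (pdx u x t / u x t) * (pdx v x t / v x t)
            + q * (1 - q + p * χ) * (pdx v x t / v x t) ^ 2)
          + A * (pdx v x t / (1 + v x t)) ^ 2
          + (p * Wt p q (u x t) (v x t) / u x t - p) * (- u x t * v x t + B1 x t)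
          + (q * Wt p q (u x t) (v x t) / v x t + A / (1 + v x t))
            * (u x t * v x t - v x t + B2 x t) := by
  have cX : ContinuousOn (fun z : ℝ × ℝ => z.1) (Set.Ioi (0:ℝ) ×ˢ Set.Ioi (0:ℝ)) :=
    continuous_fst.continuousOn
  have cY : ContinuousOn (fun z : ℝ × ℝ => z.2) (Set.Ioi (0:ℝ) ×ˢ Set.Ioi (0:ℝ)) :=
    continuous_snd.continuousOn
  have pX : ∀ z ∈ (Set.Ioi (0:ℝ) ×ˢ Set.Ioi (0:ℝ)), 0 < (z : ℝ × ℝ).1 := fun z hz => hz.1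
  have pY : ∀ z ∈ (Set.Ioi (0:ℝ) ×ˢ Set.Ioi (0:ℝ)), 0 < (z : ℝ × ℝ).2 := fun z hz => hz.2
  have cY1 : ContinuousOn (fun z : ℝ × ℝ => 1 + z.2) (Set.Ioi (0:ℝ) ×ˢ Set.Ioi (0:ℝ)) :=
    continuousOn_const.fun_add cY
  have nX := fun z hz => (pX z hz).ne'
  have nY := fun z hz => (pY z hz).ne'
  have nY1 : ∀ z ∈ (Set.Ioi (0:ℝ) ×ˢ Set.Ioi (0:ℝ)), 1 + (z : ℝ × ℝ).2 ≠ 0 := fun z hz => by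
    have := pY z hz; positivity
  have cW : ContinuousOn (fun z : ℝ × ℝ => Wt p q z.1 z.2) (Set.Ioi (0:ℝ) ×ˢ Set.Ioi (0:ℝ)) :=
    Wt_cont p q
  have k0 : ContQ (fun X Y => Wt p q X Y - p * X + A * Real.log (1 + Y)) :=
    (cW.fun_sub (continuousOn_const.fun_mul cX)).fun_add
      (continuousOn_const.fun_mul (cY1.log nY1))
  have k1 : ContQ (fun X Y => p * Wt p q X Y / X - p) := by
    have h : ContinuousOn (fun z : ℝ × ℝ => p * Wt p q z.1 z.2 / z.1)
      (Set.Ioi (0:ℝ) ×ˢ Set.Ioi (0:ℝ)) := (continuousOn_const.fun_mul cW).div cX nX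
    exact h.fun_sub continuousOn_const
  have k2 : ContQ (fun X Y => q * Wt p q X Y / Y + A / (1 + Y)) := by
    have h : ContinuousOn (fun z : ℝ × ℝ => q * Wt p q z.1 z.2 / z.2)
      (Set.Ioi (0:ℝ) ×ˢ Set.Ioi (0:ℝ)) := (continuousOn_const.fun_mul cW).div cY nY
    have h' : ContinuousOn (fun z : ℝ × ℝ => A / (1 + z.2))
      (Set.Ioi (0:ℝ) ×ˢ Set.Ioi (0:ℝ)) := continuousOn_const.div cY1 nY1
    exact h.fun_add h'
  have k11 : ContQ (fun X Y => p * (p - 1) * Wt p q X Y / X ^ 2) :=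
    (continuousOn_const.fun_mul cW).div (cX.fun_pow 2) (fun z hz => pow_ne_zero 2 (nX z hz))
  have k12 : ContQ (fun X Y => p * q * Wt p q X Y / (X * Y)) :=
    (continuousOn_const.fun_mul cW).div (cX.fun_mul cY)
      (fun z hz => mul_ne_zero (nX z hz) (nY z hz))
  have k22 : ContQ (fun X Y => q * (q - 1) * Wt p q X Y / Y ^ 2 - A / (1 + Y) ^ 2) := by
    have h : ContinuousOn (fun z : ℝ × ℝ => q * (q - 1) * Wt p q z.1 z.2 / z.2 ^ 2)
      (Set.Ioi (0:ℝ) ×ˢ Set.Ioi (0:ℝ)) :=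
      (continuousOn_const.fun_mul cW).div (cY.fun_pow 2) (fun z hz => pow_ne_zero 2 (nY z hz))
    have h' : ContinuousOn (fun z : ℝ × ℝ => A / (1 + z.2) ^ 2)
      (Set.Ioi (0:ℝ) ×ˢ Set.Ioi (0:ℝ)) :=
      continuousOn_const.div (cY1.fun_pow 2) (fun z hz => pow_ne_zero 2 (nY1 z hz))
    exact h.fun_sub h'
  have h := hsol.functional hab hB1 hB2 k0 k1 k2 k11 k12 k22
    (by
      intro f g f' g' s hf0 hg0 hf hg
      have h1 : 1 + g s ≠ 0 := by positivity
      refine (((Wt_chain p q f g f' g' s hf0 hg0 hf hg).fun_sub (hf.const_mul p)).fun_add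
        (((hg.const_add 1).log h1).const_mul A)).congr_deriv ?_
      field_simp
      ring)
    (by
      intro f g f' g' s hf0 hg0 hf hg
      refine (((((Wt_chain p q f g f' g' s hf0 hg0 hf hg).const_mul p).fun_div hf
        hf0.ne')).sub_const p).congr_deriv ?_
      field_simp
      ring)
    (by
      intro f g f' g' s hf0 hg0 hf hg
      have h1 : 1 + g s ≠ 0 := by positivity
      refine (((((Wt_chain p q f g f' g' s hf0 hg0 hf hg).const_mul q).fun_div hg
        hg0.ne')).fun_add ((hasDerivAt_const s A).fun_div (hg.const_add 1) h1)).congr_deriv ?_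
      field_simp
      ring) ht
  refine ⟨_, h.1, h.2, fun x hx => ?_⟩
  have hu := hsol.u_pos x hx t ht
  have hv := hsol.v_pos x hx t ht
  have h1 : 1 + v x t ≠ 0 := by positivity
  simp only [Igd]
  field_simp
  ring

lemma core_pw {p q A w X Y M1 β1 β2 R c r s d : ℝ} (hp0 : 0 < p) (hp1 : p < 1) (hq : 0 < q)
    (hpq : p + q < 1) (hA : 0 ≤ A) (hw0 : 0 < w) (hw : w ≤ 1 + X + Y) (hX : 0 < X) (hY : 0 < Y)
    (h1 : 0 ≤ β1) (h1M : β1 ≤ M1) (h2 : 0 ≤ β2) (hR : c * (r ^ 2 + s ^ 2) ≤ R) :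
    c * (w * r ^ 2 + w * s ^ 2) + A * d ^ 2 - p * (1 + Y) ^ 2 - (1 + X + Y) - (M1 + A)
      ≤ w * R + A * d ^ 2 + (p * w / X - p) * (- X * Y + β1)
        + (q * w / Y + A / (1 + Y)) * (X * Y - Y + β2) := by
  have e1 : c * (w * r ^ 2 + w * s ^ 2) ≤ w * R := by nlinarith
  have e2 : (p * w / X - p) * (- X * Y + β1)
    = - p * w * Y + p * X * Y + p * w / X * β1 - p * β1 := by field_simp; ring
  have e3 : (q * w / Y) * (X * Y - Y + β2) = q * w * X - q * w + q * w / Y * β2 := by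
    field_simp
  have e4 : -A ≤ A / (1 + Y) * (X * Y - Y + β2) := by
    have : A / (1 + Y) * (X * Y - Y + β2) + A = A * (X * Y + 1 + β2) / (1 + Y) := by
      field_simp; ring
    have h' : 0 ≤ A * (X * Y + 1 + β2) / (1 + Y) := by positivity
    linarith
  have f1 : 0 ≤ p * w / X * β1 := by positivity
  have f2 : 0 ≤ q * w / Y * β2 := by positivity
  have f3 : 0 ≤ q * w * X := by positivity
  have f4 : p * w * Y ≤ p * (1 + X + Y) * Y := by gcongr
  have f5 : q * w ≤ 1 * (1 + X + Y) := by gcongr; linarith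
  have f6 : p * β1 ≤ 1 * M1 := by gcongr
  rw [add_mul (q * w / Y), e2, e3]
  nlinarith

lemma core_lemma (hab : a < b) (hB1 : HypB a b B1) (hB2 : HypB a b B2)
    (hsol : CrimeSol a b χ B1 B2 u0 v0 u v Tmax) (hχ : 0 < χ)
    {p q : ℝ} (hp : p ∈ Set.Ioo (0:ℝ) 1) (hpχ : p < 1 / χ^2)
    (hq : q ∈ Set.Ioo (qminus χ p) (qplus χ p)) (m τ : ℝ) (hm : 0 ≤ m) (hτ0 : 0 ≤ τ)
    (hτ1 : τ ≤ 1) :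
    ∃ C : ℝ, 0 < C ∧ ∀ t : ℝ, 0 < t → ENNReal.ofReal (t + τ) < Tmax →
      (∀ s ∈ Set.Icc t (t + τ), ∫ x in a..b, (u x s + v x s) ≤ m) →
      (∫ s in t..(t + τ), ∫ x in Set.Ioo a b, u x s ^ (p - 2) * v x s ^ q * (pdx u x s) ^ 2) ≤ C ∧
      (∫ s in t..(t + τ), ∫ x in Set.Ioo a b, u x s ^ p * v x s ^ (q - 2) * (pdx v x s) ^ 2)
        ≤ C := by
  obtain ⟨hq0, hpq, c, hc, hquad⟩ := quad_form hχ hp hpχ hq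
  obtain ⟨hp0, hp1⟩ := hp
  obtain ⟨M1, hM1⟩ := hB1.2.1
  have hM1' : 0 ≤ M1 := (hB1.1 0 0).trans (hM1 0 0)
  have hl : 0 < b - a := sub_pos.2 hab
  set K := (b - a) + m with hKdef
  have hK : 0 < K := by positivity
  set A := p * K ^ 2 with hA
  have hA0 : 0 ≤ A := by positivity
  set Q := p * (2 * K ^ 2 / (b - a)) + K + (M1 + A) * (b - a) with hQ
  have hQ0 : 0 ≤ Q := by positivity
  refine ⟨(Q + (K + A * m) + m) / c, by positivity, fun t ht htT hmass => ?_⟩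
  have hsub : Set.Icc t (t + τ) ⊆ It' Tmax := Icc_sub_It' ht htT
  have htt : t ≤ t + τ := by linarith
  -- the two dissipation terms
  set P1 : ℝ → ℝ → ℝ := fun x s => Wt p q (u x s) (v x s) * (pdx u x s / u x s) ^ 2 with hP1
  set P2 : ℝ → ℝ → ℝ := fun x s => Wt p q (u x s) (v x s) * (pdx v x s / v x s) ^ 2 with hP2
  have hu := hsol.u_cont.mono (Set.prod_mono_right (It'_sub Tmax))
  have hv := hsol.v_cont.mono (Set.prod_mono_right (It'_sub Tmax))
  have hux : ContinuousOn (fun z : ℝ × ℝ => pdx u z.1 z.2) (Set.Icc a b ×ˢ It' Tmax) :=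
    continuous_fst.comp_continuousOn hsol.u_cont21
  have hvx : ContinuousOn (fun z : ℝ × ℝ => pdx v z.1 z.2) (Set.Icc a b ×ˢ It' Tmax) :=
    continuous_fst.comp_continuousOn hsol.v_cont21
  have cW := hsol.comp_cont (Wt_cont p q)
  have cP1 : ContinuousOn (fun z : ℝ × ℝ => P1 z.1 z.2) (Set.Icc a b ×ˢ It' Tmax) :=
    cW.mul ((hux.div hu (fun z hz => (hsol.u_pos _ hz.1 _ hz.2).ne')).pow 2)
  have cP2 : ContinuousOn (fun z : ℝ × ℝ => P2 z.1 z.2) (Set.Icc a b ×ˢ It' Tmax) :=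
    cW.mul ((hvx.div hv (fun z hz => (hsol.v_pos _ hz.1 _ hz.2).ne')).pow 2)
  have cD1 : ContinuousOn (fun s => ∫ x in a..b, P1 x s) (Set.Icc t (t + τ)) :=
    (cont_param hab.le cP1).mono hsub
  have cD2 : ContinuousOn (fun s => ∫ x in a..b, P2 x s) (Set.Icc t (t + τ)) :=
    (cont_param hab.le cP2).mono hsub
  have P1nn : ∀ s ∈ Set.Icc t (t + τ), 0 ≤ ∫ x in a..b, P1 x s := fun s hs =>
    intervalIntegral.integral_nonneg hab.le (fun x hx => mul_nonneg
      (Wt_pos (hsol.u_pos x hx s (hsub hs)) (hsol.v_pos x hx s (hsub hs))).le (sq_nonneg _))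
  have P2nn : ∀ s ∈ Set.Icc t (t + τ), 0 ≤ ∫ x in a..b, P2 x s := fun s hs =>
    intervalIntegral.integral_nonneg hab.le (fun x hx => mul_nonneg
      (Wt_pos (hsol.u_pos x hx s (hsub hs)) (hsol.v_pos x hx s (hsub hs))).le (sq_nonneg _))
  -- the functional
  set H : ℝ → ℝ := fun s => ∫ x in a..b, (Wt p q (u x s) (v x s) - p * u x s
        + A * Real.log (1 + v x s)) with hH
  have cG : ContinuousOn (fun z : ℝ × ℝ => Wt p q (u z.1 z.2) (v z.1 z.2) - p * u z.1 z.2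
      + A * Real.log (1 + v z.1 z.2)) (Set.Icc a b ×ˢ It' Tmax) :=
    (cW.sub (continuousOn_const.mul hu)).add (continuousOn_const.mul
      ((continuousOn_const.add hv).log (fun z hz => by
        have := hsol.v_pos _ hz.1 _ hz.2
        exact (show (0:ℝ) < 1 + v z.1 z.2 by linarith).ne')))
  have cH : ContinuousOn H (Set.Icc t (t + τ)) :=
    (cont_param hab.le (f := fun x s => Wt p q (u x s) (v x s) - p * u x s
        + A * Real.log (1 + v x s)) cG).mono hsub
  -- basic bounds at a fixed time
  have basic : ∀ s ∈ Set.Icc t (t + τ), ∫ x in a..b, u x s ≤ m ∧ ∫ x in a..b, v x s ≤ m ∧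
      (∫ x in a..b, (1 + u x s + v x s)) ≤ K ∧ ∫ x in a..b, (1 + v x s) ≤ K := by
    intro s hs
    have hs' := hsub hs
    have su := hsol.slice_u (It'_sub _ hs')
    have sv := hsol.slice_v (It'_sub _ hs')
    have i3 := ii_of_cont hab.le su
    have i4 := ii_of_cont hab.le sv
    have U0 : 0 ≤ ∫ x in a..b, u x s := intervalIntegral.integral_nonneg hab.le
        (fun x hx => (hsol.u_pos x hx s hs').le)
    have V0 : 0 ≤ ∫ x in a..b, v x s := intervalIntegral.integral_nonneg hab.le
        (fun x hx => (hsol.v_pos x hx s hs').le)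
    have h := hmass s hs
    rw [intervalIntegral.integral_add i3 i4] at h
    rw [intervalIntegral.integral_add (intervalIntegrable_const.add i3) i4,
      intervalIntegral.integral_add intervalIntegrable_const i3,
      intervalIntegral.integral_add intervalIntegrable_const i4,
      intervalIntegral.integral_const, smul_eq_mul, mul_one]
    refine ⟨?_, ?_, ?_, ?_⟩ <;> linarith
  have Hup : ∀ s ∈ Set.Icc t (t + τ), H s ≤ K + A * m := by
    intro s hs
    have hs' := hsub hs
    obtain ⟨-, b2, b3, -⟩ := basic s hs
    have su := hsol.slice_u (It'_sub _ hs')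
    have sv := hsol.slice_v (It'_sub _ hs')
    have j1 := ii_of_cont hab.le ((continuousOn_const (c := (1:ℝ)).fun_add su).fun_add sv)
    have j2 := ii_of_cont hab.le (continuousOn_const (c := A).fun_mul sv)
    have h1 : H s ≤ ∫ x in a..b, ((1 + u x s + v x s) + A * v x s) := by
      refine intervalIntegral.integral_mono_on hab.le
        (ii_of_cont hab.le (cont_slice (f := fun x s => Wt p q (u x s) (v x s) - p * u x s
        + A * Real.log (1 + v x s)) cG hs')) (j1.add j2) (fun x hx => ?_)
      have pu := hsol.u_pos x hx s hs'
      have pv := hsol.v_pos x hx s hs'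
      have h2 := Wt_le hp0 hq0 hpq pu pv
      have h3 := Real.log_le_sub_one_of_pos (show 0 < 1 + v x s by linarith)
      have h4 : A * Real.log (1 + v x s) ≤ A * v x s :=
        mul_le_mul_of_nonneg_left (by linarith) hA0
      have h5 : 0 < p * u x s := mul_pos hp0 pu
      show Wt p q (u x s) (v x s) - p * u x s + A * Real.log (1 + v x s)
        ≤ 1 + u x s + v x s + A * v x s
      linarith
    rw [intervalIntegral.integral_add j1 j2, intervalIntegral.integral_const_mul] at h1
    have := mul_le_mul_of_nonneg_left b2 hA0
    linarith
  have Hlow : ∀ s ∈ Set.Icc t (t + τ), -m ≤ H s := by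
    intro s hs
    have hs' := hsub hs
    obtain ⟨b1, -, -, -⟩ := basic s hs
    have su := hsol.slice_u (It'_sub _ hs')
    have h1 : ∫ x in a..b, - u x s ≤ H s := by
      refine intervalIntegral.integral_mono_on hab.le (ii_of_cont hab.le su.fun_neg)
        (ii_of_cont hab.le (cont_slice (f := fun x s => Wt p q (u x s) (v x s) - p * u x s
        + A * Real.log (1 + v x s)) cG hs')) (fun x hx => ?_)
      have pu := hsol.u_pos x hx s hs'
      have pv := hsol.v_pos x hx s hs'
      have h2 := Wt_pos (p := p) (q := q) pu pv
      have h3 : 0 ≤ A * Real.log (1 + v x s) :=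
        mul_nonneg hA0 (Real.log_nonneg (by linarith))
      have h5 : p * u x s ≤ 1 * u x s := by gcongr
      show - u x s ≤ Wt p q (u x s) (v x s) - p * u x s + A * Real.log (1 + v x s)
      linarith
    rw [intervalIntegral.integral_neg] at h1
    linarith
  -- the differential inequality
  have key : ∀ s ∈ Set.Icc t (t + τ), ∃ h' : ℝ, HasDerivAt H h' s ∧
      c * ((∫ x in a..b, P1 x s) + ∫ x in a..b, P2 x s) - Q ≤ h' := by
    intro s hs
    have hs' := hsub hs
    obtain ⟨-, -, b3, b4⟩ := basic s hs
    obtain ⟨I, cI, dI, eI⟩ := core_deriv hab hB1 hB2 hsol p q A hs'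
    refine ⟨_, dI, ?_⟩
    have su := hsol.slice_u (It'_sub _ hs')
    have sv := hsol.slice_v (It'_sub _ hs')
    have svx := hsol.slice_vx hs'
    have s1v := continuousOn_const (c := (1:ℝ)).fun_add sv
    have n1v : ∀ x ∈ Set.Icc a b, 1 + v x s ≠ 0 := fun x hx => by
      have := hsol.v_pos x hx s hs'; positivity
    have sd : ContinuousOn (fun x => pdx v x s / (1 + v x s)) (Set.Icc a b) := svx.div s1v n1v
    have j1 := ii_of_cont hab.le (cont_slice cP1 hs')
    have j2 := ii_of_cont hab.le (cont_slice cP2 hs')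
    have j3 := ii_of_cont hab.le (sd.fun_pow 2)
    have j4 := ii_of_cont hab.le (s1v.fun_pow 2)
    have j5 := ii_of_cont hab.le ((continuousOn_const (c := (1:ℝ)).fun_add su).fun_add sv)
    have h1 : ∫ x in a..b, (c * (P1 x s + P2 x s) + A * (pdx v x s / (1 + v x s)) ^ 2
        - p * (1 + v x s) ^ 2 - (1 + u x s + v x s) - (M1 + A)) ≤ ∫ x in a..b, I x := by
      refine intervalIntegral.integral_mono_on hab.le
        ((((((j1.add j2).const_mul c).add (j3.const_mul A)).sub (j4.const_mul p)).sub j5).sub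
          intervalIntegrable_const) (ii_of_cont hab.le cI) (fun x hx => ?_)
      have pu := hsol.u_pos x hx s hs'
      have pv := hsol.v_pos x hx s hs'
      rw [eI x hx]
      exact core_pw hp0 hp1 hq0 hpq hA0 (Wt_pos pu pv) (Wt_le hp0 hq0 hpq pu pv) pu pv
        (hB1.1 x s) (hM1 x s) (hB2.1 x s) (hquad _ _)
    rw [intervalIntegral.integral_sub (((((j1.add j2).const_mul c).add (j3.const_mul A)).sub
        (j4.const_mul p)).sub j5) intervalIntegrable_const,
      intervalIntegral.integral_sub ((((j1.add j2).const_mul c).add (j3.const_mul A)).sub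
        (j4.const_mul p)) j5,
      intervalIntegral.integral_sub (((j1.add j2).const_mul c).add (j3.const_mul A))
        (j4.const_mul p),
      intervalIntegral.integral_add ((j1.add j2).const_mul c) (j3.const_mul A),
      intervalIntegral.integral_const_mul, intervalIntegral.integral_const_mul,
      intervalIntegral.integral_const_mul, intervalIntegral.integral_add j1 j2,
      intervalIntegral.integral_const, smul_eq_mul] at h1
    have h2 := nonlocal hab hK (g := fun x => v x s) (g' := fun x => pdx v x s)
      (fun x hx => hsol.v_pos x hx s hs') (fun x hx => (hsol.v_reg x hx s hs').1.hasDerivAt)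
      svx b4
    have h3 := mul_le_mul_of_nonneg_left h2 hp0.le
    rw [mul_add, ← mul_assoc p (K ^ 2), ← hA] at h3
    rw [hQ]
    linarith
  choose! H' hH' hkey using key
  have hfin := intervalIntegral.integral_le_sub_of_hasDeriv_right_of_le
    (φ := fun s => c * ((∫ x in a..b, P1 x s) + ∫ x in a..b, P2 x s) - Q) htt cH
    (fun s hs => (hH' s (Set.Ioo_subset_Icc_self hs)).hasDerivWithinAt)
    (((continuousOn_const.fun_mul (cD1.fun_add cD2)).fun_sub continuousOn_const).integrableOn_Icc)
    (fun s hs => hkey s (Set.Ioo_subset_Icc_self hs))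
  have l1 := ii_of_cont htt cD1
  have l2 := ii_of_cont htt cD2
  rw [intervalIntegral.integral_sub ((l1.add l2).const_mul c) intervalIntegrable_const,
    intervalIntegral.integral_const_mul, intervalIntegral.integral_add l1 l2,
    intervalIntegral.integral_const, smul_eq_mul, add_sub_cancel_left] at hfin
  have q1 := Hup _ (Set.right_mem_Icc.2 htt)
  have q2 := Hlow _ (Set.left_mem_Icc.2 htt)
  have q3 : τ * Q ≤ 1 * Q := by gcongr
  have z1 : 0 ≤ ∫ s in t..(t + τ), ∫ x in a..b, P1 x s :=
    intervalIntegral.integral_nonneg htt P1nn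
  have z2 : 0 ≤ ∫ s in t..(t + τ), ∫ x in a..b, P2 x s :=
    intervalIntegral.integral_nonneg htt P2nn
  have tot : (∫ s in t..(t + τ), ∫ x in a..b, P1 x s) + (∫ s in t..(t + τ), ∫ x in a..b, P2 x s)
      ≤ (Q + (K + A * m) + m) / c := by
    rw [le_div_iff₀ hc]
    linarith
  have E1 : (∫ s in t..(t + τ), ∫ x in Set.Ioo a b,
      u x s ^ (p - 2) * v x s ^ q * (pdx u x s) ^ 2) = ∫ s in t..(t + τ), ∫ x in a..b, P1 x s := by
    refine intervalIntegral.integral_congr (fun s hs => ?_)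
    rw [Set.uIcc_of_le htt] at hs
    simp only [intervalIntegral.integral_of_le hab.le, integral_Ioc_eq_integral_Ioo]
    refine setIntegral_congr_fun measurableSet_Ioo (fun x hx => ?_)
    have pu := hsol.u_pos x (Set.Ioo_subset_Icc_self hx) s (hsub hs)
    simp only [hP1, Wt]
    rw [Real.rpow_sub pu, Real.rpow_two]
    field_simp
  have E2 : (∫ s in t..(t + τ), ∫ x in Set.Ioo a b,
      u x s ^ p * v x s ^ (q - 2) * (pdx v x s) ^ 2) = ∫ s in t..(t + τ), ∫ x in a..b, P2 x s := by
    refine intervalIntegral.integral_congr (fun s hs => ?_)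
    rw [Set.uIcc_of_le htt] at hs
    simp only [intervalIntegral.integral_of_le hab.le, integral_Ioc_eq_integral_Ioo]
    refine setIntegral_congr_fun measurableSet_Ioo (fun x hx => ?_)
    have pv := hsol.v_pos x (Set.Ioo_subset_Icc_self hx) s (hsub hs)
    simp only [hP2, Wt]
    rw [Real.rpow_sub pv, Real.rpow_two]
    field_simp
  rw [E1, E2]
  constructor <;> linarith

end core

/-- Lemma 3.3 (fundamental estimates from the functional `∫_Ω u^p v^q`). -/
theorem fundamental_estimates
    (a b χ : ℝ) (hab : a < b) (hχ : 0 < χ)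
    (B1 B2 : ℝ → ℝ → ℝ) (hB1 : HypB a b B1) (hB2 : HypB a b B2)
    (u0 v0 : ℝ → ℝ) (hinit : HypInit a b u0 v0)
    (Tmax : ℝ≥0∞) (hT : 0 < Tmax)
    (u v : ℝ → ℝ → ℝ) (hsol : CrimeSol a b χ B1 B2 u0 v0 u v Tmax)
    (p : ℝ) (hp : p ∈ Set.Ioo (0:ℝ) 1) (hpχ : p < 1 / χ^2)
    (q : ℝ) (hq : q ∈ Set.Ioo (qminus χ p) (qplus χ p)) :
    (∀ T : ℝ, 0 < T → ∃ C : ℝ, 0 < C ∧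
      ∀ t : ℝ, 0 < t →
        ENNReal.ofReal (t + tauOf Tmax) < min (ENNReal.ofReal T) Tmax →
        (∫ s in t..(t + tauOf Tmax),
            ∫ x in Set.Ioo a b, u x s ^ (p - 2) * v x s ^ q * (pdx u x s) ^ 2) ≤ C ∧
        (∫ s in t..(t + tauOf Tmax),
            ∫ x in Set.Ioo a b, u x s ^ p * v x s ^ (q - 2) * (pdx v x s) ^ 2) ≤ C) ∧
    ((HypH1 a b B1 ∨ HypH2 a b B2) → ∃ C : ℝ, 0 < C ∧
      ∀ t : ℝ, 0 < t → ENNReal.ofReal (t + tauOf Tmax) < Tmax →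
        (∫ s in t..(t + tauOf Tmax),
            ∫ x in Set.Ioo a b, u x s ^ (p - 2) * v x s ^ q * (pdx u x s) ^ 2) ≤ C ∧
        (∫ s in t..(t + tauOf Tmax),
            ∫ x in Set.Ioo a b, u x s ^ p * v x s ^ (q - 2) * (pdx v x s) ^ 2) ≤ C) := by
  have hτ0 : 0 ≤ tauOf Tmax := ENNReal.toReal_nonneg
  have hτ1 : tauOf Tmax ≤ 1 := by
    have := ENNReal.toReal_mono ENNReal.one_ne_top (min_le_left (1:ℝ≥0∞) (Tmax / 3))
    simpa [tauOf] using this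
  constructor
  · intro T hT0
    obtain ⟨m, hm⟩ := mass1 hab hB1 hB2 hsol T
    obtain ⟨C, hC, h⟩ := core_lemma hab hB1 hB2 hsol hχ hp hpχ hq (max m 0) (tauOf Tmax)
      (le_max_right _ _) hτ0 hτ1
    refine ⟨C, hC, fun t ht htT => ?_⟩
    obtain ⟨h1, h2⟩ := lt_min_iff.1 htT
    have h1' : t + tauOf Tmax < T := (ENNReal.ofReal_lt_ofReal_iff hT0).1 h1
    exact h t ht h2 (fun s hs => (hm s (Icc_sub_It' ht h2 hs) (hs.2.trans h1'.le)).trans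
      (le_max_left _ _))
  · intro hH
    obtain ⟨m, hm⟩ : ∃ m : ℝ, ∀ t ∈ It' Tmax, ∫ x in a..b, (u x t + v x t) ≤ m := by
      rcases hH with h | h
      · exact mass_H1 hab hB1 hB2 hsol hinit h
      · exact mass_H2 hab hB1 hB2 hsol hinit h
    obtain ⟨C, hC, h⟩ := core_lemma hab hB1 hB2 hsol hχ hp hpχ hq (max m 0) (tauOf Tmax)
      (le_max_right _ _) hτ0 hτ1
    exact ⟨C, hC, fun t ht h2 => h t ht h2 (fun s hs => (hm s (Icc_sub_It' ht h2 hs)).trans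
      (le_max_left _ _))⟩
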